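/- arXiv:2511.11779 — 5 statements merged into one kernel-verified Lean document; each statement's English description precedes it below -/
import Mathlib

section
/- If f(q) = q + ∑_{k=2}^∞ qᵏ pₖ belongs to the class S* of slice starlike functions on the open unit ball 𝔹 of the quaternions, then |q| + ∑_{k=2}^∞ |q|ᵏ |pₖ| ≤ 1 for every q ∈ 𝔹 with |q| ≤ (3 − √5)/2. -/
noncomputable section
open scoped Quaternion

/-- Value of the slice regular function with Taylor coefficients `p` at `q`. -/
noncomputable def sliceVal (p : ℕ → ℍ[ℝ]) (q : ℍ[ℝ]) : ℍ[ℝ] := ∑' k : ℕ, q ^ k * p k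

/-- Slice derivative: `f'(q) = ∑_{k≥1} q^{k-1} k p_k`. -/
noncomputable def sliceDeriv (p : ℕ → ℍ[ℝ]) (q : ℍ[ℝ]) : ℍ[ℝ] :=
  ∑' k : ℕ, q ^ k * (((k : ℝ) + 1) • p (k + 1))

/-- The power series with coefficients `p` converges on the open unit ball. -/
def SliceRegOn (p : ℕ → ℍ[ℝ]) : Prop :=
  ∀ q : ℍ[ℝ], ‖q‖ < 1 → Summable fun k : ℕ => q ^ k * p k

/-- The class `S*` of slice starlike functions `f(q) = q + ∑_{k≥2} q^k p_k`. -/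
def SliceStarlike (p : ℕ → ℍ[ℝ]) : Prop :=
  SliceRegOn p ∧ p 0 = 0 ∧ p 1 = 1 ∧
    (∀ q : ℍ[ℝ], ‖q‖ < 1 → q ≠ 0 → sliceVal p q ≠ 0) ∧
    (∀ q : ℍ[ℝ], ‖q‖ < 1 → q ≠ 0 → 0 < ((sliceVal p q)⁻¹ * q * sliceDeriv p q).re)

def PS (a : PowerSeries ℂ) (f : ℂ → ℂ) : Prop :=
  ∀ z : ℂ, ‖z‖ < 1 → HasSum (fun n => PowerSeries.coeff n a * z ^ n) (f z)

namespace PS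
open PowerSeries

lemma add {a b f g} (ha : PS a f) (hb : PS b g) : PS (a + b) (fun z => f z + g z) := by
  intro z hz
  simpa [add_mul] using (ha z hz).add (hb z hz)

lemma neg {a f} (ha : PS a f) : PS (-a) (fun z => - f z) := by
  intro z hz
  simpa using (ha z hz).neg

lemma sub {a b f g} (ha : PS a f) (hb : PS b g) : PS (a - b) (fun z => f z - g z) := by
  simpa [sub_eq_add_neg] using ha.add hb.neg

lemma smul {a f} (c : ℂ) (ha : PS a f) : PS (C c * a) (fun z => c * f z) := by
  intro z hz
  simpa [mul_assoc] using (ha z hz).mul_left c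

lemma mul {a b f g} (ha : PS a f) (hb : PS b g) : PS (a * b) (fun z => f z * g z) := by
  intro z hz
  have h1 := (ha z hz).summable.norm
  have h2 := (hb z hz).summable.norm
  have h3 := tsum_mul_tsum_eq_tsum_sum_antidiagonal_of_summable_norm h1 h2
  have h4 := (summable_norm_sum_mul_antidiagonal_of_summable_norm h1 h2).of_norm
  rw [(ha z hz).tsum_eq, (hb z hz).tsum_eq] at h3
  have h5 : (fun n => PowerSeries.coeff n (a * b) * z ^ n) = fun n => ∑ kl ∈ Finset.HasAntidiagonal.antidiagonal n,
      PowerSeries.coeff kl.1 a * z ^ kl.1 * (PowerSeries.coeff kl.2 b * z ^ kl.2) := by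
    ext n
    rw [PowerSeries.coeff_mul, Finset.sum_mul]
    refine Finset.sum_congr rfl fun kl h => ?_
    rw [← Finset.HasAntidiagonal.mem_antidiagonal.1 h, pow_add]; ring
  simp only [h5, h3]
  exact h4.hasSum

lemma congr {a f g} (ha : PS a f) (h : ∀ z : ℂ, ‖z‖ < 1 → f z = g z) : PS a g := by
  intro z hz
  rw [← h z hz]; exact ha z hz

lemma hasF {a f} (ha : PS a f) :
    HasFPowerSeriesOnBall f (FormalMultilinearSeries.ofScalars ℂ (fun n => PowerSeries.coeff n a)) 0 1 := by
  refine ⟨?_, by simp, ?_⟩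
  · refine ENNReal.le_of_forall_nnreal_lt fun r hr => ?_
    refine FormalMultilinearSeries.le_radius_of_summable _ ?_
    have hr' : ‖((r : ℝ) : ℂ)‖ < 1 := by simpa using hr
    have := (ha _ hr').summable.norm
    refine this.of_nonneg_of_le (fun n => by positivity) fun n => ?_
    simp [FormalMultilinearSeries.ofScalars_norm]
  · intro y hy
    have hy' : ‖y‖ < 1 := by simpa [← ofReal_norm, ENNReal.ofReal_lt_one] using hy
    simpa [FormalMultilinearSeries.ofScalars_apply_eq, smul_eq_mul, mul_comm] using ha y hy'

lemma diff {a f} (ha : PS a f) : DifferentiableOn ℂ f (Metric.ball 0 1) := by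
  have := ha.hasF.differentiableOn
  rwa [← ENNReal.ofReal_one, Metric.eball_ofReal] at this

lemma unique {a b f} (ha : PS a f) (hb : PS b f) : a = b := by
  have := ha.hasF.hasFPowerSeriesAt.eq_formalMultilinearSeries hb.hasF.hasFPowerSeriesAt
  ext n
  have h2 := congrArg (fun p => FormalMultilinearSeries.coeff p n) this
  simpa using h2

lemma exists_of_diff {f : ℂ → ℂ} (hf : DifferentiableOn ℂ f (Metric.ball 0 1)) : ∃ a, PS a f := by
  refine ⟨PowerSeries.mk fun n => (n.factorial : ℂ)⁻¹ * iteratedDeriv n f 0, fun z hz => ?_⟩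
  have := Complex.hasSum_taylorSeries_on_ball (c := 0) (r := 1) hf (z := z) (by simpa using hz)
  simpa [mul_comm, mul_left_comm] using this

lemma one : PS 1 (fun _ => 1) := by
  intro z hz
  have := hasSum_ite_eq (0:ℕ) (1:ℂ)
  refine this.congr_fun ?_ |> fun h => h
  intro n
  by_cases h : n = 0 <;> simp [h, PowerSeries.coeff_one]

lemma inv {a f} (ha : PS a f) (hf : ∀ z : ℂ, ‖z‖ < 1 → f z ≠ 0) : PS a⁻¹ (fun z => (f z)⁻¹) := by
  have hd : DifferentiableOn ℂ (fun z => (f z)⁻¹) (Metric.ball 0 1) :=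
    ha.diff.fun_inv fun z hz => hf z (by simpa using hz)
  obtain ⟨b, hb⟩ := exists_of_diff hd
  have h1 : a * b = 1 := (ha.mul hb).unique (one.congr fun z hz => (mul_inv_cancel₀ (hf z hz)).symm)
  have h0 : constantCoeff a ≠ 0 := by
    intro h
    have := congrArg constantCoeff h1
    simp [h] at this
  have : a⁻¹ = b := by
    have h2 := PowerSeries.inv_mul_cancel a h0
    calc a⁻¹ = a⁻¹ * (a * b) := by rw [h1, mul_one]
      _ = b := by rw [← mul_assoc, h2, one_mul]
  rwa [this]

lemma integral {a f} (ha : PS a f) (r : ℝ) (hr0 : 0 ≤ r) (hr : r < 1) (k : ℤ) :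
    HasSum (fun n : ℕ => if (n : ℤ) + k = 0 then 2 * Real.pi * (PowerSeries.coeff n a * (r:ℂ) ^ n) else 0)
    (∫ θ in (0:ℝ)..(2 * Real.pi), f (r * Complex.exp (θ * Complex.I)) * Complex.exp (k * θ * Complex.I)) := by
  have key : HasSum (fun n : ℕ => ∫ θ in (0:ℝ)..(2 * Real.pi), PowerSeries.coeff n a * (r:ℂ) ^ n * Complex.exp ((n + k : ℤ) * θ * Complex.I))
    (∫ θ in (0:ℝ)..(2 * Real.pi), ∑' n : ℕ, PowerSeries.coeff n a * (r:ℂ) ^ n * Complex.exp ((n + k : ℤ) * θ * Complex.I)) := by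
    have hs := (ha (r:ℂ) (by simpa [abs_of_nonneg hr0] using hr)).summable.norm
    let F : ℕ → C(ℝ, ℂ) := fun n => ⟨fun θ : ℝ => PowerSeries.coeff n a * (r:ℂ) ^ n * Complex.exp ((n + k : ℤ) * θ * Complex.I), by fun_prop⟩
    refine intervalIntegral.hasSum_intervalIntegral_of_summable_norm (f := F) ?_
    refine hs.of_nonneg_of_le (fun n => by positivity) fun n => ?_
    refine (ContinuousMap.norm_le _ (norm_nonneg _)).2 fun x => ?_
    simp only [F, ContinuousMap.restrict_apply, ContinuousMap.coe_mk, norm_mul]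
    rw [show ((n + k : ℤ) : ℂ) * ((x : ℝ):ℂ) * Complex.I = (((n + k : ℤ) * (x:ℝ) : ℝ) : ℂ) * Complex.I by push_cast; ring, Complex.norm_exp_ofReal_mul_I, mul_one]
  convert key using 1
  · ext n
    rw [intervalIntegral.integral_const_mul]
    split_ifs with h
    · rw [h]; simp; ring
    · have hne : ((n + k : ℤ) : ℂ) * Complex.I ≠ 0 := mul_ne_zero (by exact_mod_cast h) Complex.I_ne_zero
      have := integral_exp_mul_complex (a := 0) (b := 2 * Real.pi) hne
      have h2 : ∀ θ : ℝ, ((n + k : ℤ) : ℂ) * θ * Complex.I = ((n + k : ℤ) : ℂ) * Complex.I * θ := fun θ => by ring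
      simp only [h2, this]
      have h3 : ((n + k : ℤ) : ℂ) * Complex.I * ((2 * Real.pi : ℝ) : ℂ) = ((n + k : ℤ) : ℂ) * (2 * Real.pi * Complex.I) := by push_cast; ring
      rw [h3, Complex.exp_int_mul_two_pi_mul_I]
      simp
  · refine intervalIntegral.integral_congr fun θ _ => ?_
    have hz : ‖(r:ℂ) * Complex.exp (θ * Complex.I)‖ < 1 := by
      rw [norm_mul, Complex.norm_exp_ofReal_mul_I]; simpa [abs_of_nonneg hr0] using hr
    have h := ((ha _ hz).mul_right (Complex.exp (k * θ * Complex.I))).tsum_eq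
    rw [← h]
    congr 1; ext n
    rw [mul_pow, ← Complex.exp_nat_mul]
    push_cast
    rw [add_mul, add_mul, Complex.exp_add]; ring_nf

lemma cara {a f} (ha : PS a f) (h0 : PowerSeries.coeff 0 a = 1) (hf : ∀ z : ℂ, ‖z‖ < 1 → 0 < (f z).re)
    (n : ℕ) (hn : 1 ≤ n) : ‖PowerSeries.coeff n a‖ ≤ 2 := by
  have main : ∀ r : ℝ, 0 ≤ r → r < 1 → ‖PowerSeries.coeff n a‖ * r ^ n ≤ 2 := by
    intro r hr0 hr
    by_cases hz : PowerSeries.coeff n a = 0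
    · simp [hz]
    set A := PowerSeries.coeff n a with hA
    have hA0 : (‖A‖ : ℂ) ≠ 0 := by simpa using hz
    set ε : ℂ := - (starRingEnd ℂ A) / ‖A‖ with hε
    have hεn : ‖ε‖ = 1 := by simp [hε, hz]
    let z : ℝ → ℂ := fun θ => r * Complex.exp (θ * Complex.I)
    have hzn : ∀ θ, ‖z θ‖ < 1 := fun θ => by
      simp only [z]
      rw [norm_mul, Complex.norm_exp_ofReal_mul_I]; simpa [abs_of_nonneg hr0] using hr
    have hc : Continuous fun θ => f (z θ) := by
      refine ha.diff.continuousOn.comp_continuous (by fun_prop) fun θ => by simpa using hzn θ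
    have i0 := (ha.integral r hr0 hr 0).unique (hasSum_single 0 (by intro m hm; simp [hm]))
    have i1 := (ha.integral r hr0 hr (-n)).unique (hasSum_single n (by intro m hm; rw [if_neg]; omega))
    have i2 := (ha.integral r hr0 hr n).unique (hasSum_single 0 (by intro m hm; rw [if_neg]; omega))
    rw [if_pos (by simp)] at i0
    rw [if_pos (by simp)] at i1
    rw [if_neg (by omega)] at i2
    have ic : ∀ k : ℤ, IntervalIntegrable (fun θ : ℝ => f (z θ) * Complex.exp (k * θ * Complex.I)) MeasureTheory.volume 0 (2 * Real.pi) :=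
      fun k => (hc.mul (by fun_prop)).intervalIntegrable _ _
    let G : ℝ → ℂ := fun θ => f (z θ) * Complex.exp ((0:ℤ) * θ * Complex.I) + (ε / 2 * (f (z θ) * Complex.exp ((-n : ℤ) * θ * Complex.I))
        + starRingEnd ℂ ε / 2 * (f (z θ) * Complex.exp ((n : ℤ) * θ * Complex.I)))
    have iG : ∫ θ in (0:ℝ)..(2 * Real.pi), G θ = 2 * Real.pi * (1 - ‖A‖ * r ^ n / 2 : ℝ) := by
      simp only [G]
      rw [intervalIntegral.integral_add (ic _) (((ic _).const_mul _).add ((ic _).const_mul _)),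
        intervalIntegral.integral_add ((ic _).const_mul _) ((ic _).const_mul _),
        intervalIntegral.integral_const_mul, intervalIntegral.integral_const_mul, i0, i1, i2, h0]
      have : ε * A = - ‖A‖ := by
        rw [hε, div_mul_eq_mul_div, div_eq_iff hA0, neg_mul, mul_comm, Complex.mul_conj, Complex.normSq_eq_norm_sq]
        push_cast; ring
      push_cast
      linear_combination (Real.pi * r ^ n : ℂ) * this
    have hG : ∀ θ, 0 ≤ (G θ).re := by
      intro θ
      set w := ε * Complex.exp ((-n : ℤ) * θ * Complex.I) with hw
      have hw1 : ‖w‖ = 1 := by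
        rw [hw, norm_mul, hεn, show ((-n : ℤ) : ℂ) * θ * Complex.I = ((-n * θ : ℝ) : ℂ) * Complex.I by push_cast; ring, Complex.norm_exp_ofReal_mul_I, mul_one]
      have hwc : starRingEnd ℂ w = starRingEnd ℂ ε * Complex.exp ((n : ℤ) * θ * Complex.I) := by
        rw [hw, map_mul, ← Complex.exp_conj]; simp
      have : G θ = f (z θ) * ((1 + w.re : ℝ) : ℂ) := by
        have h2 : ((w.re : ℝ) : ℂ) = (w + starRingEnd ℂ w) / 2 := by rw [Complex.add_conj]; push_cast; ring
        push_cast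
        rw [h2, hwc, hw]
        simp only [G]
        simp
        ring
      rw [this, Complex.re_mul_ofReal]
      have h3 := (abs_le.1 (Complex.abs_re_le_norm w)).1
      have := hf _ (hzn θ)
      rw [hw1] at h3
      exact mul_nonneg this.le (by linarith)
    have hGi : IntervalIntegrable G MeasureTheory.volume 0 (2 * Real.pi) := (ic _).add (((ic _).const_mul _).add ((ic _).const_mul _))
    have h5 : 0 ≤ ∫ θ in (0:ℝ)..(2 * Real.pi), (G θ).re :=
      intervalIntegral.integral_nonneg (by positivity) fun θ _ => hG θ
    have h6 : ∫ θ in (0:ℝ)..(2 * Real.pi), (G θ).re = (∫ θ in (0:ℝ)..(2 * Real.pi), G θ).re :=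
      Complex.reCLM.intervalIntegral_comp_comm hGi
    rw [h6, iG, show (2 * Real.pi * (1 - ‖A‖ * r ^ n / 2 : ℝ) : ℂ) = ((2 * Real.pi * (1 - ‖A‖ * r ^ n / 2) : ℝ) : ℂ) by push_cast; ring, Complex.ofReal_re] at h5
    have := nonneg_of_mul_nonneg_right h5 (by positivity)
    linarith
  have ht : Filter.Tendsto (fun r : ℝ => ‖PowerSeries.coeff n a‖ * r ^ n) (nhdsWithin 1 (Set.Iio 1)) (nhds (‖PowerSeries.coeff n a‖ * 1 ^ n)) :=
    ((by fun_prop : Continuous fun r : ℝ => ‖PowerSeries.coeff n a‖ * r ^ n).tendsto 1).mono_left nhdsWithin_le_nhds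
  have := le_of_tendsto ht (b := 2) (by
    filter_upwards [Ioo_mem_nhdsLT (show (0:ℝ) < 1 by norm_num)] with r hr
    exact main r hr.1.le hr.2)
  simpa using this
end PS
open scoped Quaternion

/-- real and imaginary parts of a complexified quaternion -/
def reQ (U : ℍ[ℂ]) : ℍ[ℝ] := ⟨U.re.re, U.imI.re, U.imJ.re, U.imK.re⟩
def imQ (U : ℍ[ℂ]) : ℍ[ℝ] := ⟨U.re.im, U.imI.im, U.imJ.im, U.imK.im⟩

def mkQ (a b c d : ℝ) : ℍ[ℝ] := ⟨a, b, c, d⟩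
@[simp] lemma mkQ_re (a b c d : ℝ) : (mkQ a b c d).re = a := rfl
@[simp] lemma mkQ_imI (a b c d : ℝ) : (mkQ a b c d).imI = b := rfl
@[simp] lemma mkQ_imJ (a b c d : ℝ) : (mkQ a b c d).imJ = c := rfl
@[simp] lemma mkQ_imK (a b c d : ℝ) : (mkQ a b c d).imK = d := rfl
@[simp] lemma reQ_re (U : ℍ[ℂ]) : (reQ U).re = U.re.re := rfl
@[simp] lemma reQ_imI (U : ℍ[ℂ]) : (reQ U).imI = U.imI.re := rfl
@[simp] lemma reQ_imJ (U : ℍ[ℂ]) : (reQ U).imJ = U.imJ.re := rfl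
@[simp] lemma reQ_imK (U : ℍ[ℂ]) : (reQ U).imK = U.imK.re := rfl
@[simp] lemma imQ_re (U : ℍ[ℂ]) : (imQ U).re = U.re.im := rfl
@[simp] lemma imQ_imI (U : ℍ[ℂ]) : (imQ U).imI = U.imI.im := rfl
@[simp] lemma imQ_imJ (U : ℍ[ℂ]) : (imQ U).imJ = U.imJ.im := rfl
@[simp] lemma imQ_imK (U : ℍ[ℂ]) : (imQ U).imK = U.imK.im := rfl

lemma reQ_mul (U V : ℍ[ℂ]) : reQ (U * V) = reQ U * reQ V - imQ U * imQ V := by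
  ext <;> simp <;> ring

lemma imQ_mul (U V : ℍ[ℂ]) : imQ (U * V) = reQ U * imQ V + imQ U * reQ V := by
  ext <;> simp <;> ring

lemma J_iff (J : ℍ[ℝ]) (h0 : J.re = 0) (h1 : Quaternion.normSq J = 1) : J * J = -1 := by
  have := Quaternion.sq_eq_neg_normSq.2 h0
  rw [h1] at this
  rw [← pow_two, this]; simp

lemma J_re {J : ℍ[ℝ]} (h : J * J = -1) : J.re = 0 ∧ Quaternion.normSq J = 1 := by
  have h1 : Quaternion.normSq J = 1 := by
    have := congrArg Quaternion.normSq h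
    rw [map_mul, Quaternion.normSq_neg, map_one] at this
    have h0 := Quaternion.normSq_nonneg (a := J)
    nlinarith
  refine ⟨Quaternion.sq_eq_neg_normSq.1 ?_, h1⟩
  rw [pow_two, h, h1]; simp

lemma exists_zero_of_normSq (U : ℍ[ℂ]) (h : Quaternion.normSq U = 0) :
    ∃ J : ℍ[ℝ], J * J = -1 ∧ reQ U + J * imQ U = 0 := by
  have e1 : Quaternion.normSq (reQ U) = Quaternion.normSq (imQ U) := by
    have := congrArg Complex.re h
    rw [Quaternion.normSq_def'] at this ⊢
    rw [Quaternion.normSq_def']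
    simp [pow_two] at this ⊢
    linarith
  have e2 : (reQ U * star (imQ U)).re = 0 := by
    have := congrArg Complex.im h
    rw [Quaternion.normSq_def'] at this
    simp [pow_two] at this ⊢
    linarith
  by_cases hb : imQ U = 0
  · have ha : reQ U = 0 := by rw [hb] at e1; simpa using e1
    refine ⟨mkQ 0 1 0 0, J_iff _ rfl ?_, by simp [ha, hb]⟩
    simp [Quaternion.normSq_def']
  · have hb' : Quaternion.normSq (imQ U) ≠ 0 := Quaternion.normSq_ne_zero.2 hb
    refine ⟨-(reQ U * (imQ U)⁻¹), J_iff _ ?_ ?_, ?_⟩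
    · rw [Quaternion.re_neg, Quaternion.inv_def, mul_smul_comm, Quaternion.re_smul, e2]; simp
    · rw [Quaternion.normSq_neg, map_mul, Quaternion.normSq_inv, e1, mul_inv_cancel₀ hb']
    · rw [neg_mul, mul_assoc, inv_mul_cancel₀ hb]; simp

lemma pos_transfer (U V G : ℍ[ℂ]) (hUV : U * V = G)
    (hne : ∀ J : ℍ[ℝ], J * J = -1 → reQ U + J * imQ U ≠ 0)
    (hpos : ∀ J : ℍ[ℝ], J * J = -1 → 0 < ((reQ U + J * imQ U)⁻¹ * (reQ G + J * imQ G)).re)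
    (J' : ℍ[ℝ]) (hJ' : J' * J' = -1) : 0 < (reQ V + J' * imQ V).re := by
  have hG1 := reQ_mul U V
  have hG2 := imQ_mul U V
  rw [hUV] at hG1 hG2
  set α := reQ U
  set β := imQ U
  set A := reQ V
  set B := imQ V
  have hd : α - β * J' ≠ 0 := by
    intro h
    have hα : α = β * J' := sub_eq_zero.1 h
    by_cases hb : β = 0
    · exact hne J' hJ' (by rw [hα, hb]; simp)
    · refine hne (-(β * J' * β⁻¹)) ?_ ?_
      · calc -(β * J' * β⁻¹) * -(β * J' * β⁻¹) = β * J' * (β⁻¹ * β) * J' * β⁻¹ := by noncomm_ring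
          _ = β * (J' * J') * β⁻¹ := by rw [inv_mul_cancel₀ hb]; noncomm_ring
          _ = -1 := by rw [hJ']; simp [hb]
      · rw [neg_mul, mul_assoc _ β⁻¹, inv_mul_cancel₀ hb, hα]; simp
  set d := α - β * J' with hdd
  set J := d * J' * d⁻¹ with hJd
  have hJ : J * J = -1 := by
    calc d * J' * d⁻¹ * (d * J' * d⁻¹) = d * J' * (d⁻¹ * d) * J' * d⁻¹ := by noncomm_ring
          _ = d * (J' * J') * d⁻¹ := by rw [inv_mul_cancel₀ hd]; noncomm_ring
          _ = -1 := by rw [hJ']; simp [hd]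
  have hJ2 : J * d = d * J' := by rw [hJd, mul_assoc, inv_mul_cancel₀ hd, mul_one]
  have hcomm : J * α - β = (α + J * β) * J' := by
    have h1 : J * α - J * β * J' = α * J' - β * (J' * J') := by
      calc J * α - J * β * J' = J * d := by rw [hdd]; noncomm_ring
        _ = d * J' := hJ2
        _ = _ := by rw [hdd]; noncomm_ring
    rw [hJ'] at h1
    calc J * α - β = (J * α - J * β * J') + J * β * J' - β := by noncomm_ring
      _ = _ := by rw [h1]; noncomm_ring
  have hfac : reQ G + J * imQ G = (α + J * β) * (A + J' * B) := by
    rw [hG1, hG2]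
    calc α * A - β * B + J * (α * B + β * A) = (α + J * β) * A + (J * α - β) * B := by noncomm_ring
      _ = _ := by rw [hcomm]; noncomm_ring
  have := hpos J hJ
  rwa [hfac, ← mul_assoc, inv_mul_cancel₀ (hne J hJ), one_mul] at this

def PSR (a : PowerSeries ℝ) (f : ℂ → ℂ) : Prop := PS (a.map Complex.ofRealHom) f

namespace PSR
lemma add {a b f g} (ha : PSR a f) (hb : PSR b g) : PSR (a + b) (fun z => f z + g z) := by
  simpa [PSR] using PS.add ha hb
lemma neg {a f} (ha : PSR a f) : PSR (-a) (fun z => - f z) := by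
  simpa [PSR] using PS.neg ha
lemma sub {a b f g} (ha : PSR a f) (hb : PSR b g) : PSR (a - b) (fun z => f z - g z) := by
  simpa [PSR] using PS.sub ha hb
lemma mul {a b f g} (ha : PSR a f) (hb : PSR b g) : PSR (a * b) (fun z => f z * g z) := by
  simpa [PSR] using PS.mul ha hb
lemma inv {a f} (ha : PSR a f) (h0 : PowerSeries.constantCoeff a ≠ 0) (hf : ∀ z : ℂ, ‖z‖ < 1 → f z ≠ 0) :
    PSR a⁻¹ (fun z => (f z)⁻¹) := by
  have h1 := PS.inv ha hf
  have h2 : (a.map Complex.ofRealHom)⁻¹ = (a⁻¹).map Complex.ofRealHom := by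
    rw [PowerSeries.inv_eq_iff_mul_eq_one, ← map_mul, PowerSeries.inv_mul_cancel a h0, map_one]
    rw [← PowerSeries.coeff_zero_eq_constantCoeff_apply, PowerSeries.coeff_map]
    simpa using h0
  rwa [h2] at h1
lemma uniq {a f g} (ha : PSR a f) (hb : PSR a g) {z : ℂ} (hz : ‖z‖ < 1) : f z = g z :=
  (ha z hz).unique (hb z hz)
end PSR

structure PSQ (P : Quaternion (PowerSeries ℝ)) (F : ℂ → ℍ[ℂ]) : Prop where
  h0 : PSR P.re (fun z => (F z).re)
  h1 : PSR P.imI (fun z => (F z).imI)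
  h2 : PSR P.imJ (fun z => (F z).imJ)
  h3 : PSR P.imK (fun z => (F z).imK)

namespace PSQ
lemma star {P F} (h : PSQ P F) : PSQ (star P) (fun z => star (F z)) := by
  refine ⟨?_, ?_, ?_, ?_⟩
  · simpa using h.h0
  · simpa using h.h1.neg
  · simpa using h.h2.neg
  · simpa using h.h3.neg

lemma mul {P F Q G} (h : PSQ P F) (k : PSQ Q G) : PSQ (P * Q) (fun z => F z * G z) := by
  refine ⟨?_, ?_, ?_, ?_⟩
  · simpa using (((h.h0.mul k.h0).sub (h.h1.mul k.h1)).sub (h.h2.mul k.h2)).sub (h.h3.mul k.h3)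
  · simpa using (((h.h0.mul k.h1).add (h.h1.mul k.h0)).add (h.h2.mul k.h3)).sub (h.h3.mul k.h2)
  · simpa using (((h.h0.mul k.h2).sub (h.h1.mul k.h3)).add (h.h2.mul k.h0)).add (h.h3.mul k.h1)
  · simpa using (((h.h0.mul k.h3).add (h.h1.mul k.h2)).sub (h.h2.mul k.h1)).add (h.h3.mul k.h0)

lemma smul {a f P F} (h : PSR a f) (k : PSQ P F) : PSQ (a • P) (fun z => f z • F z) := by
  refine ⟨?_, ?_, ?_, ?_⟩
  · simpa using h.mul k.h0
  · simpa using h.mul k.h1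
  · simpa using h.mul k.h2
  · simpa using h.mul k.h3

lemma uniq {P F G} (h : PSQ P F) (k : PSQ P G) {z : ℂ} (hz : ‖z‖ < 1) : F z = G z := by
  ext1
  · exact h.h0.uniq k.h0 hz
  · exact h.h1.uniq k.h1 hz
  · exact h.h2.uniq k.h2 hz
  · exact h.h3.uniq k.h3 hz

lemma normSq {P F} (h : PSQ P F) : PSR (Quaternion.normSq P) (fun z => Quaternion.normSq (F z)) := by
  simpa [Quaternion.normSq_def] using (h.mul h.star).h0
end PSQ

noncomputable def qco (n : ℕ) (P : Quaternion (PowerSeries ℝ)) : ℍ[ℝ] :=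
  ⟨PowerSeries.coeff n P.re, PowerSeries.coeff n P.imI, PowerSeries.coeff n P.imJ, PowerSeries.coeff n P.imK⟩

@[simp] lemma qco_re (n : ℕ) (P : Quaternion (PowerSeries ℝ)) : (qco n P).re = PowerSeries.coeff n P.re := rfl
@[simp] lemma qco_imI (n : ℕ) (P : Quaternion (PowerSeries ℝ)) : (qco n P).imI = PowerSeries.coeff n P.imI := rfl
@[simp] lemma qco_imJ (n : ℕ) (P : Quaternion (PowerSeries ℝ)) : (qco n P).imJ = PowerSeries.coeff n P.imJ := rfl
@[simp] lemma qco_imK (n : ℕ) (P : Quaternion (PowerSeries ℝ)) : (qco n P).imK = PowerSeries.coeff n P.imK := rfl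

lemma qre_sum {ι} (s : Finset ι) (f : ι → ℍ[ℝ]) : (∑ i ∈ s, f i).re = ∑ i ∈ s, (f i).re := by
  classical
  induction s using Finset.induction_on with
  | empty => simp
  | insert a s ha ih => simp [Finset.sum_insert ha, ih]
lemma qimI_sum {ι} (s : Finset ι) (f : ι → ℍ[ℝ]) : (∑ i ∈ s, f i).imI = ∑ i ∈ s, (f i).imI := by
  classical
  induction s using Finset.induction_on with
  | empty => simp
  | insert a s ha ih => simp [Finset.sum_insert ha, ih]
lemma qimJ_sum {ι} (s : Finset ι) (f : ι → ℍ[ℝ]) : (∑ i ∈ s, f i).imJ = ∑ i ∈ s, (f i).imJ := by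
  classical
  induction s using Finset.induction_on with
  | empty => simp
  | insert a s ha ih => simp [Finset.sum_insert ha, ih]
lemma qimK_sum {ι} (s : Finset ι) (f : ι → ℍ[ℝ]) : (∑ i ∈ s, f i).imK = ∑ i ∈ s, (f i).imK := by
  classical
  induction s using Finset.induction_on with
  | empty => simp
  | insert a s ha ih => simp [Finset.sum_insert ha, ih]

lemma qco_mul (n : ℕ) (P Q : Quaternion (PowerSeries ℝ)) :
    qco n (P * Q) = ∑ kl ∈ Finset.HasAntidiagonal.antidiagonal n, qco kl.1 P * qco kl.2 Q := by
  ext <;> simp [qre_sum, qimI_sum, qimJ_sum, qimK_sum, PowerSeries.coeff_mul, Finset.sum_add_distrib, Finset.sum_sub_distrib]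

/-- The quotient series. -/
lemma exists_quot (P Q : Quaternion (PowerSeries ℝ)) (F G : ℂ → ℍ[ℂ]) (hP : PSQ P F) (hQ : PSQ Q G)
    (h1 : qco 0 P = 1) (hne : ∀ z : ℂ, ‖z‖ < 1 → Quaternion.normSq (F z) ≠ 0) :
    ∃ (R : Quaternion (PowerSeries ℝ)) (H : ℂ → ℍ[ℂ]), PSQ R H ∧ P * R = Q ∧ ∀ z : ℂ, ‖z‖ < 1 → F z * H z = G z := by
  have hN0 : PowerSeries.constantCoeff (Quaternion.normSq P) ≠ 0 := by
    have a1 := congrArg QuaternionAlgebra.re h1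
    have a2 := congrArg QuaternionAlgebra.imI h1
    have a3 := congrArg QuaternionAlgebra.imJ h1
    have a4 := congrArg QuaternionAlgebra.imK h1
    simp at a1 a2 a3 a4
    rw [Quaternion.normSq_def']
    simp [a1, a2, a3, a4]
  have hN := hP.normSq.inv hN0 hne
  have hR := PSQ.smul hN (hP.star.mul hQ)
  have hPR : P * ((Quaternion.normSq P)⁻¹ • (star P * Q)) = Q := by
    rw [← Quaternion.coe_mul_eq_smul, ← mul_assoc, ← Quaternion.coe_commutes, mul_assoc, ← mul_assoc P, Quaternion.self_mul_star, Quaternion.coe_mul_eq_smul, Quaternion.coe_mul_eq_smul, smul_smul, PowerSeries.inv_mul_cancel _ hN0, one_smul]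
  refine ⟨_, _, hR, hPR, fun z hz => ?_⟩
  have := hP.mul hR
  rw [hPR] at this
  exact this.uniq hQ hz

lemma coeff_bound (R : Quaternion (PowerSeries ℝ)) (H : ℂ → ℍ[ℂ]) (hR : PSQ R H) (h1 : qco 0 R = 1)
    (hpos : ∀ z : ℂ, ‖z‖ < 1 → ∀ J : ℍ[ℝ], J * J = -1 → 0 < (reQ (H z) + J * imQ (H z)).re)
    (n : ℕ) (hn : 1 ≤ n) : ‖qco n R‖ ≤ 2 := by
  set c := qco n R with hc
  obtain ⟨I, hI, hcI⟩ : ∃ I : ℍ[ℝ], I * I = -1 ∧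
      ‖c‖ ^ 2 = c.re ^ 2 + (I.imI * c.imI + I.imJ * c.imJ + I.imK * c.imK) ^ 2 := by
    have hsq : ‖c‖ ^ 2 = c.re ^ 2 + (c.imI ^ 2 + c.imJ ^ 2 + c.imK ^ 2) := by
      rw [pow_two, ← Quaternion.normSq_eq_norm_mul_self, Quaternion.normSq_def']; ring
    set s := c.imI ^ 2 + c.imJ ^ 2 + c.imK ^ 2 with hs
    have hs0 : 0 ≤ s := by positivity
    by_cases h : s = 0
    · have b1 : c.imI = 0 := by nlinarith [sq_nonneg c.imI, sq_nonneg c.imJ, sq_nonneg c.imK]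
      refine ⟨mkQ 0 1 0 0, J_iff _ rfl (by simp [Quaternion.normSq_def']), ?_⟩
      rw [hsq, h]; simp [b1]
    · have hsp : 0 < s := lt_of_le_of_ne hs0 (Ne.symm h)
      have hq : Real.sqrt s ^ 2 = s := Real.sq_sqrt hs0
      have hq0 : Real.sqrt s ≠ 0 := (Real.sqrt_pos.2 hsp).ne'
      refine ⟨mkQ 0 (c.imI / Real.sqrt s) (c.imJ / Real.sqrt s) (c.imK / Real.sqrt s), J_iff _ rfl ?_, ?_⟩
      · simp [Quaternion.normSq_def', div_pow, hq]
        rw [← add_div, ← add_div, ← hs, div_self h]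
      · simp only [mkQ_imI, mkQ_imJ, mkQ_imK]
        have : c.imI / Real.sqrt s * c.imI + c.imJ / Real.sqrt s * c.imJ + c.imK / Real.sqrt s * c.imK = Real.sqrt s := by
          field_simp
          rw [hq, hs]
        rw [this, hsq, hq]
  have hIre := (J_re hI).1
  have hps : PS (R.re.map Complex.ofRealHom + PowerSeries.C Complex.I *
      (PowerSeries.C (I.imI : ℂ) * R.imI.map Complex.ofRealHom + PowerSeries.C (I.imJ : ℂ) * R.imJ.map Complex.ofRealHom
        + PowerSeries.C (I.imK : ℂ) * R.imK.map Complex.ofRealHom))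
      (fun z => (H z).re + Complex.I * (I.imI * (H z).imI + I.imJ * (H z).imJ + I.imK * (H z).imK)) :=
    PS.add hR.h0 (PS.smul _ (PS.add (PS.add (PS.smul _ hR.h1) (PS.smul _ hR.h2)) (PS.smul _ hR.h3)))
  have := hps.cara ?_ ?_ n hn
  · have h2 : ‖c‖ ^ 2 = ‖(c.re : ℂ) + Complex.I * (I.imI * c.imI + I.imJ * c.imJ + I.imK * c.imK)‖ ^ 2 := by
      rw [hcI, Complex.sq_norm, Complex.normSq_apply]
      simp; ring
    have h3 : ‖c‖ = ‖(c.re : ℂ) + Complex.I * (I.imI * c.imI + I.imJ * c.imJ + I.imK * c.imK)‖ := by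
      exact (sq_eq_sq₀ (norm_nonneg _) (norm_nonneg _)).1 h2
    rw [h3]
    simpa [hc] using this
  · have a1 := congrArg QuaternionAlgebra.re h1
    have a2 := congrArg QuaternionAlgebra.imI h1
    have a3 := congrArg QuaternionAlgebra.imJ h1
    have a4 := congrArg QuaternionAlgebra.imK h1
    simp only [qco_re, qco_imI, qco_imJ, qco_imK] at a1 a2 a3 a4
    simp only [map_add, PowerSeries.coeff_C_mul, PowerSeries.coeff_map, a1, a2, a3, a4]
    simp
  · intro z hz
    have := hpos z hz I hI
    simp [hIre] at this ⊢
    linarith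

lemma hasSum_mkQ {a b c d : ℕ → ℝ} {x y z w : ℝ} (ha : HasSum a x) (hb : HasSum b y) (hc : HasSum c z) (hd : HasSum d w) :
    HasSum (fun k => mkQ (a k) (b k) (c k) (d k)) (mkQ x y z w) := by
  have key : ∀ a b c d : ℝ, mkQ a b c d = a • mkQ 1 0 0 0 + b • mkQ 0 1 0 0 + c • mkQ 0 0 1 0 + d • mkQ 0 0 0 1 := by
    intro a b c d
    ext <;> simp
  simp only [key (a _), key x]
  exact (((ha.smul_const _).add (hb.smul_const _)).add (hc.smul_const _)).add (hd.smul_const _)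

noncomputable def toS (u : ℕ → ℍ[ℝ]) : Quaternion (PowerSeries ℝ) :=
  ⟨PowerSeries.mk fun k => (u k).re, PowerSeries.mk fun k => (u k).imI, PowerSeries.mk fun k => (u k).imJ, PowerSeries.mk fun k => (u k).imK⟩
@[simp] lemma toS_re (u : ℕ → ℍ[ℝ]) : (toS u).re = PowerSeries.mk fun k => (u k).re := rfl
@[simp] lemma toS_imI (u : ℕ → ℍ[ℝ]) : (toS u).imI = PowerSeries.mk fun k => (u k).imI := rfl
@[simp] lemma toS_imJ (u : ℕ → ℍ[ℝ]) : (toS u).imJ = PowerSeries.mk fun k => (u k).imJ := rfl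
@[simp] lemma toS_imK (u : ℕ → ℍ[ℝ]) : (toS u).imK = PowerSeries.mk fun k => (u k).imK := rfl

lemma qco_toS (n : ℕ) (u : ℕ → ℍ[ℝ]) : qco n (toS u) = u n := by
  ext <;> simp only [qco_re, qco_imI, qco_imJ, qco_imK, toS_re, toS_imI, toS_imJ, toS_imK, PowerSeries.coeff_mk]

def ConvQ (u : ℕ → ℍ[ℝ]) : Prop := ∀ t : ℝ, 0 ≤ t → t < 1 → Summable fun k => t ^ k * ‖u k‖

lemma q_norm_sq (a : ℍ[ℝ]) : ‖a‖ ^ 2 = a.re ^ 2 + a.imI ^ 2 + a.imJ ^ 2 + a.imK ^ 2 := by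
  rw [pow_two, ← Quaternion.normSq_eq_norm_mul_self, Quaternion.normSq_def']

lemma psr_of_bound (a : ℕ → ℝ) (u : ℕ → ℍ[ℝ]) (hu : ConvQ u) (h : ∀ k, a k ^ 2 ≤ ‖u k‖ ^ 2) :
    PSR (PowerSeries.mk a) (fun z => ∑' k, (a k : ℂ) * z ^ k) := by
  intro z hz
  have : Summable fun k => (a k : ℂ) * z ^ k := by
    refine Summable.of_norm_bounded (hu ‖z‖ (norm_nonneg _) hz) fun k => ?_
    rw [norm_mul, norm_pow, mul_comm, Complex.norm_real]
    exact mul_le_mul_of_nonneg_left (abs_le_of_sq_le_sq (h k) (norm_nonneg _)) (by positivity)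
  simpa using this.hasSum

lemma slice_pow (z : ℂ) (J : ℍ[ℝ]) (hJ : J * J = -1) (k : ℕ) :
    ((z.re : ℍ[ℝ]) + z.im • J) ^ k = (((z ^ k).re : ℝ) : ℍ[ℝ]) + (z ^ k).im • J := by
  have hs : ∀ a b c d : ℝ, ((a : ℍ[ℝ]) + b • J) * ((c : ℍ[ℝ]) + d • J) = ((a * c - b * d : ℝ) : ℍ[ℝ]) + (a * d + b * c) • J := by
    intro a b c d
    have h1 : ∀ x : ℝ, (x : ℍ[ℝ]) = x • (1 : ℍ[ℝ]) := fun x => by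
      rw [← Quaternion.coe_mul_eq_smul, mul_one]
    simp only [h1, mul_add, add_mul, smul_mul_smul_comm, hJ, one_mul, mul_one]
    module
  induction k with
  | zero => simp
  | succ k ih => rw [pow_succ, ih, hs, pow_succ, Complex.mul_re, Complex.mul_im]

lemma exists_stem (u : ℕ → ℍ[ℝ]) (hu : ConvQ u) : ∃ F : ℂ → ℍ[ℂ], PSQ (toS u) F ∧
    ∀ z : ℂ, ‖z‖ < 1 → ∀ J : ℍ[ℝ], J * J = -1 →
      HasSum (fun k => ((z.re : ℍ[ℝ]) + z.im • J) ^ k * u k) (reQ (F z) + J * imQ (F z)) := by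
  let F : ℂ → ℍ[ℂ] := fun z => ⟨∑' k, ((u k).re : ℂ) * z ^ k, ∑' k, ((u k).imI : ℂ) * z ^ k,
    ∑' k, ((u k).imJ : ℂ) * z ^ k, ∑' k, ((u k).imK : ℂ) * z ^ k⟩
  have h0 := psr_of_bound (fun k => (u k).re) u hu (fun k => by rw [q_norm_sq]; nlinarith [sq_nonneg (u k).imI, sq_nonneg (u k).imJ, sq_nonneg (u k).imK])
  have h1 := psr_of_bound (fun k => (u k).imI) u hu (fun k => by rw [q_norm_sq]; nlinarith [sq_nonneg (u k).re, sq_nonneg (u k).imJ, sq_nonneg (u k).imK])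
  have h2 := psr_of_bound (fun k => (u k).imJ) u hu (fun k => by rw [q_norm_sq]; nlinarith [sq_nonneg (u k).re, sq_nonneg (u k).imI, sq_nonneg (u k).imK])
  have h3 := psr_of_bound (fun k => (u k).imK) u hu (fun k => by rw [q_norm_sq]; nlinarith [sq_nonneg (u k).re, sq_nonneg (u k).imI, sq_nonneg (u k).imJ])
  have hF : PSQ (toS u) F := ⟨h0, h1, h2, h3⟩
  refine ⟨F, hF, fun z hz J hJ => ?_⟩
  have hre := hasSum_mkQ (Complex.hasSum_re (hF.h0 z hz)) (Complex.hasSum_re (hF.h1 z hz)) (Complex.hasSum_re (hF.h2 z hz)) (Complex.hasSum_re (hF.h3 z hz))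
  have him := hasSum_mkQ (Complex.hasSum_im (hF.h0 z hz)) (Complex.hasSum_im (hF.h1 z hz)) (Complex.hasSum_im (hF.h2 z hz)) (Complex.hasSum_im (hF.h3 z hz))
  have hall := hre.add (him.mul_left J)
  change HasSum _ (reQ (F z) + J * imQ (F z)) at hall
  refine hall.congr_fun ?_
  intro k
  rw [slice_pow z J hJ k, add_mul, Quaternion.coe_mul_eq_smul, smul_mul_assoc, ← mul_smul_comm]
  congr 1
  · ext <;> simp [mul_comm]
  · congr 1
    ext <;> simp [mul_comm]

lemma slice_norm (z : ℂ) (J : ℍ[ℝ]) (hJ : J * J = -1) : ‖(z.re : ℍ[ℝ]) + z.im • J‖ = ‖z‖ := by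
  obtain ⟨h0, h1⟩ := J_re hJ
  rw [Quaternion.normSq_def', h0] at h1
  refine (sq_eq_sq₀ (norm_nonneg _) (norm_nonneg _)).1 ?_
  rw [q_norm_sq, Complex.sq_norm, Complex.normSq_apply]
  simp [h0]
  linear_combination z.im ^ 2 * h1

lemma convQ_deriv (p : ℕ → ℍ[ℝ]) (hp : ConvQ p) : ConvQ (fun k => ((k : ℝ) + 1) • p (k + 1)) := by
  intro t ht0 ht
  obtain ⟨s, hts, hs1⟩ := exists_between ht
  have hs0 : 0 < s := lt_of_le_of_lt ht0 hts
  obtain ⟨M, hM⟩ := (hp s hs0.le hs1).tendsto_atTop_zero.bddAbove_range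
  have hM' : ∀ k, s ^ k * ‖p k‖ ≤ M := fun k => hM ⟨k, rfl⟩
  have hts' : ‖t / s‖ < 1 := by
    rw [Real.norm_of_nonneg (by positivity)]; exact (div_lt_one hs0).2 hts
  have hg : Summable fun k : ℕ => (M / s) * ((k : ℝ) * (t / s) ^ k + (t / s) ^ k) := by
    refine Summable.mul_left _ (Summable.add ?_ (summable_geometric_of_norm_lt_one hts'))
    simpa using summable_pow_mul_geometric_of_norm_lt_one 1 hts'
  refine hg.of_nonneg_of_le (fun k => by positivity) fun k => ?_
  rw [norm_smul, Real.norm_of_nonneg (by positivity)]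
  have h1 : ‖p (k + 1)‖ ≤ M / s ^ (k + 1) := by
    rw [le_div_iff₀ (by positivity), mul_comm]; exact hM' _
  calc t ^ k * (((k : ℝ) + 1) * ‖p (k + 1)‖) ≤ t ^ k * (((k : ℝ) + 1) * (M / s ^ (k + 1))) := by gcongr
    _ = _ := by rw [div_pow, pow_succ]; field_simp

lemma convQ_shift (p : ℕ → ℍ[ℝ]) (hp : ConvQ p) : ConvQ (fun k => p (k + 1)) := by
  intro t ht0 ht
  refine (convQ_deriv p hp t ht0 ht).of_nonneg_of_le (fun k => by positivity) fun k => ?_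
  rw [norm_smul, Real.norm_of_nonneg (by positivity)]
  gcongr
  nlinarith [norm_nonneg (p (k + 1)), (Nat.cast_nonneg k : (0:ℝ) ≤ k)]

lemma convQ_of_reg (p : ℕ → ℍ[ℝ]) (hp : SliceRegOn p) : ConvQ p := by
  intro t ht0 ht
  have := (hp (t : ℍ[ℝ]) (by simpa [abs_of_nonneg ht0] using ht)).norm
  simpa [abs_of_nonneg ht0] using this

lemma starlike_bound (p : ℕ → ℍ[ℝ]) (hf : SliceStarlike p) (n : ℕ) : ‖p (n + 1)‖ ≤ n + 1 := by
  obtain ⟨hreg, hp0, hp1, hnz, hpos⟩ := hf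
  have hconv := convQ_of_reg p hreg
  obtain ⟨F, hF, hFs⟩ := exists_stem _ (convQ_shift p hconv)
  obtain ⟨G, hG, hGs⟩ := exists_stem _ (convQ_deriv p hconv)
  have hval : ∀ z : ℂ, ‖z‖ < 1 → ∀ J : ℍ[ℝ], J * J = -1 →
      sliceVal p ((z.re : ℍ[ℝ]) + z.im • J) = ((z.re : ℍ[ℝ]) + z.im • J) * (reQ (F z) + J * imQ (F z)) := by
    intro z hz J hJ
    have h1 := (hFs z hz J hJ).mul_left ((z.re : ℍ[ℝ]) + z.im • J)
    have h2 := hreg _ (by rw [slice_norm z J hJ]; exact hz)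
    rw [sliceVal, h2.tsum_eq_zero_add, hp0, mul_zero, zero_add, ← h1.tsum_eq]
    simp only [pow_succ', mul_assoc]
  have hder : ∀ z : ℂ, ‖z‖ < 1 → ∀ J : ℍ[ℝ], J * J = -1 →
      sliceDeriv p ((z.re : ℍ[ℝ]) + z.im • J) = reQ (G z) + J * imQ (G z) :=
    fun z hz J hJ => (hGs z hz J hJ).tsum_eq
  have hq0 : ∀ z : ℂ, z ≠ 0 → ∀ J : ℍ[ℝ], J * J = -1 → ((z.re : ℍ[ℝ]) + z.im • J) ≠ 0 := by
    intro z hz J hJ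
    rw [← norm_ne_zero_iff, slice_norm z J hJ]
    exact norm_ne_zero_iff.2 hz
  have hz1 : ∀ (u : ℕ → ℍ[ℝ]) (x : ℍ[ℝ]) (J : ℍ[ℝ]), HasSum (fun k => (((0:ℂ).re : ℍ[ℝ]) + (0:ℂ).im • J) ^ k * u k) x → x = u 0 := by
    intro u x J h
    refine h.unique ?_
    convert hasSum_single 0 ?_ using 1
    · simp
    · intro m hm; simp [hm]
  have hne : ∀ z : ℂ, ‖z‖ < 1 → ∀ J : ℍ[ℝ], J * J = -1 → reQ (F z) + J * imQ (F z) ≠ 0 := by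
    intro z hz J hJ h
    by_cases hz0 : z = 0
    · subst hz0
      have := hz1 _ _ _ (hFs 0 hz J hJ)
      rw [h] at this
      simp [hp1] at this
    · refine hnz _ (by rw [slice_norm z J hJ]; exact hz) (hq0 z hz0 J hJ) ?_
      rw [hval z hz J hJ, h, mul_zero]
  have hpos' : ∀ z : ℂ, ‖z‖ < 1 → ∀ J : ℍ[ℝ], J * J = -1 →
      0 < ((reQ (F z) + J * imQ (F z))⁻¹ * (reQ (G z) + J * imQ (G z))).re := by
    intro z hz J hJ
    by_cases hz0 : z = 0
    · subst hz0
      rw [hz1 _ _ _ (hFs 0 hz J hJ), hz1 _ _ _ (hGs 0 hz J hJ)]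
      simp [hp1]
    · have := hpos _ (by rw [slice_norm z J hJ]; exact hz) (hq0 z hz0 J hJ)
      rw [hval z hz J hJ, hder z hz J hJ, mul_inv_rev, inv_mul_cancel_right₀ (hq0 z hz0 J hJ)] at this
      exact this
  obtain ⟨R, H, hRH, hPR, hFH⟩ := exists_quot _ _ F G hF hG (by rw [qco_toS]; exact hp1)
    (fun z hz h => by
      obtain ⟨J, hJ, h0⟩ := exists_zero_of_normSq _ h
      exact hne z hz J hJ h0)
  have hrec : ∀ n : ℕ, ((n : ℝ) + 1) • p (n + 1) = ∑ kl ∈ Finset.HasAntidiagonal.antidiagonal n, p (kl.1 + 1) * qco kl.2 R := by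
    intro n
    have h := qco_mul n (toS fun k => p (k + 1)) R
    rw [hPR, qco_toS] at h
    simpa only [qco_toS] using h
  have hc0 : qco 0 R = 1 := by
    have := hrec 0
    simpa [hp1] using this.symm
  have hc : ∀ n, 1 ≤ n → ‖qco n R‖ ≤ 2 := coeff_bound R H hRH hc0
    (fun z hz J hJ => pos_transfer (F z) (H z) (G z) (hFH z hz) (hne z hz) (hpos' z hz) J hJ)
  induction n using Nat.strong_induction_on with
  | _ n ih =>
    rcases Nat.eq_zero_or_pos n with h | h
    · subst h; simp [hp1]
    have h1 := hrec n
    rw [Finset.Nat.sum_antidiagonal_eq_sum_range_succ (fun i j => p (i + 1) * qco j R), Finset.sum_range_succ, Nat.sub_self, hc0, mul_one, add_smul, one_smul, add_left_inj] at h1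
    have h2 : (n : ℝ) * ‖p (n + 1)‖ ≤ ∑ i ∈ Finset.range n, ((i : ℝ) + 1) * 2 := by
      calc (n : ℝ) * ‖p (n + 1)‖ = ‖(n : ℝ) • p (n + 1)‖ := by rw [norm_smul, Real.norm_of_nonneg (by positivity)]
        _ ≤ ∑ i ∈ Finset.range n, ‖p (i + 1) * qco (n - i) R‖ := by rw [h1]; exact norm_sum_le _ _
        _ ≤ _ := by
          refine Finset.sum_le_sum fun i hi => ?_
          have hi' := Finset.mem_range.1 hi
          rw [norm_mul]
          exact mul_le_mul (ih i hi') (hc _ (by omega)) (norm_nonneg _) (by positivity)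
    have h3 : ∀ n : ℕ, ∑ i ∈ Finset.range n, ((i : ℝ) + 1) * 2 = n * (n + 1) := by
      intro n
      induction n with
      | zero => simp
      | succ k ihk => rw [Finset.sum_range_succ, ihk]; push_cast; ring
    rw [h3] at h2
    exact le_of_mul_le_mul_left h2 (by exact_mod_cast h)

theorem bohr_slice_starlike (p : ℕ → ℍ[ℝ]) (hf : SliceStarlike p)
    (q : ℍ[ℝ]) (hq : ‖q‖ < 1) (hqr : ‖q‖ ≤ (3 - Real.sqrt 5) / 2) :
    ‖q‖ + ∑' k : ℕ, ‖q‖ ^ (k + 2) * ‖p (k + 2)‖ ≤ 1 := by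
  have hb := starlike_bound p hf
  set r := ‖q‖ with hr
  have hr0 : 0 ≤ r := norm_nonneg _
  have hs := hasSum_coe_mul_geometric_of_norm_lt_one (r := r) (by rwa [Real.norm_of_nonneg hr0])
  have hs2 := (hasSum_nat_add_iff' 2).2 hs
  have hle : ∀ k : ℕ, r ^ (k + 2) * ‖p (k + 2)‖ ≤ ((k + 2 : ℕ) : ℝ) * r ^ (k + 2) := by
    intro k
    rw [mul_comm]
    refine mul_le_mul_of_nonneg_right ?_ (by positivity)
    have := hb (k + 1)
    push_cast at this ⊢
    linarith
  have hsum := hs2.summable.of_nonneg_of_le (fun k => by positivity) hle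
  have h1 := hsum.tsum_le_tsum hle hs2.summable
  rw [hs2.tsum_eq] at h1
  simp [Finset.sum_range_succ] at h1
  have h2 : r / (1 - r) ^ 2 ≤ 1 := by
    rw [div_le_one (by nlinarith)]
    have h5 : Real.sqrt 5 ≤ 3 - 2 * r := by linarith
    have h6 : (Real.sqrt 5) ^ 2 ≤ (3 - 2 * r) ^ 2 := pow_le_pow_left₀ (Real.sqrt_nonneg _) h5 2
    rw [Real.sq_sqrt (by norm_num)] at h6
    nlinarith
  linarith
end
end

section
/- The constant (3 − √5)/2 in the Bohr theorem for slice starlike functions is best possible: for every r with (3 − √5)/2 < r < 1 there exist a function f(q) = q + ∑_{k=2}^∞ qᵏ pₖ in the class S* and a point q ∈ 𝔹 with |q| = r such that |q| + ∑_{k=2}^∞ |q|ᵏ |pₖ| > 1 (for instance f(q) = ∑_{k=1}^∞ qᵏ k u^{k−1} for a unit quaternion u). -/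
noncomputable section
open scoped Quaternion

lemma koebe_val {q : ℍ[ℝ]} (hq : ‖q‖ < 1) :
    HasSum (fun k : ℕ => q ^ k * (k : ℍ[ℝ])) (q / (1 - q) ^ 2) := by
  have h := hasSum_coe_mul_geometric_of_norm_lt_one hq
  refine h.congr_fun ?_
  intro k
  exact ((Nat.cast_commute k (q ^ k)).eq).symm

lemma koebe_deriv {q : ℍ[ℝ]} (hq : ‖q‖ < 1) :
    HasSum (fun k : ℕ => q ^ k * (((k : ℝ) + 1) • ((k + 1 : ℕ) : ℍ[ℝ])))
      (2 * (1 / (1 - q) ^ 3) - 1 / (1 - q) ^ 2) := by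
  have h2 := (hasSum_choose_mul_geometric_of_norm_lt_one 2 hq).mul_left 2
  have h1 := hasSum_choose_mul_geometric_of_norm_lt_one 1 hq
  have h := h2.sub h1
  refine h.congr_fun ?_
  intro k
  have e : ((k : ℝ) + 1) • ((k + 1 : ℕ) : ℍ[ℝ]) = (((k + 1) * (k + 1) : ℕ) : ℍ[ℝ]) := by
    have : ((k : ℝ) + 1) = ((k + 1 : ℕ) : ℝ) := by push_cast; rfl
    rw [this, Nat.cast_smul_eq_nsmul, nsmul_eq_mul]
    push_cast; rfl
  rw [e, (Nat.cast_commute _ (q ^ k)).symm.eq, ← mul_assoc, ← sub_mul]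
  congr 1
  have hn : 2 * (k + 2).choose 2 = (k + 1) * (k + 1) + (k + 1).choose 1 := by
    have := Nat.triangle_succ (k + 1)
    rw [Nat.choose_two_right, Nat.choose_one_right]
    rw [Nat.mul_div_cancel' (by
      have := (Nat.even_mul_pred_self (k + 2)).two_dvd
      exact this)]
    simp
    ring
  rw [eq_sub_iff_add_eq]
  have hc := congrArg (Nat.cast : ℕ → ℍ[ℝ]) hn.symm
  rw [Nat.cast_add, Nat.cast_mul 2] at hc
  exact hc

lemma koebe_re {q : ℍ[ℝ]} (hq : ‖q‖ < 1) : 0 < (2 * (1 - q)⁻¹ - 1).re := by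
  have ha : (1 - q) ≠ 0 := by
    intro h
    rw [sub_eq_zero] at h
    rw [← h] at hq
    simp at hq
  have hn : Quaternion.normSq q < 1 := by
    rw [Quaternion.normSq_eq_norm_mul_self]; nlinarith [norm_nonneg q]
  have hp : 0 < Quaternion.normSq (1 - q) :=
    lt_of_le_of_ne Quaternion.normSq_nonneg (Ne.symm (Quaternion.normSq_ne_zero.2 ha))
  have e : (2 * (1 - q)⁻¹ - 1).re
      = (1 - Quaternion.normSq q) / Quaternion.normSq (1 - q) := by
    rw [two_mul, Quaternion.inv_def, eq_div_iff hp.ne']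
    simp only [Quaternion.re_sub, Quaternion.re_add, Quaternion.re_smul, Quaternion.re_star,
      Quaternion.re_one, smul_eq_mul]
    have : ((Quaternion.normSq (1 - q))⁻¹ * (1 - q.re) + (Quaternion.normSq (1 - q))⁻¹ * (1 - q.re) - 1)
      * Quaternion.normSq (1 - q) = 2 * (1 - q.re) - Quaternion.normSq (1 - q) := by
      field_simp; ring
    rw [this, Quaternion.normSq_def', Quaternion.normSq_def']
    simp
    ring
  rw [e]
  exact div_pos (by linarith) hp

lemma koebe_starlike : SliceStarlike (fun k : ℕ => (k : ℍ[ℝ])) := by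
  refine ⟨fun q hq => (koebe_val hq).summable, by simp, by simp, ?_, ?_⟩
  all_goals
    intro q hq hq0
    have ha : (1 - q) ≠ 0 := by
      intro h
      rw [sub_eq_zero] at h
      rw [← h] at hq
      simp at hq
    have hv : sliceVal (fun k : ℕ => (k : ℍ[ℝ])) q = q / (1 - q) ^ 2 := (koebe_val hq).tsum_eq
    rw [hv]
  · exact div_ne_zero hq0 (pow_ne_zero _ ha)
  · have hd : sliceDeriv (fun k : ℕ => (k : ℍ[ℝ])) q
        = 2 * (1 / (1 - q) ^ 3) - 1 / (1 - q) ^ 2 := (koebe_deriv hq).tsum_eq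
    rw [hd]
    have e1 : (q / (1 - q) ^ 2)⁻¹ * q = (1 - q) ^ 2 := by
      rw [inv_div, div_mul_cancel₀ _ hq0]
    have e2 : (1 - q) ^ 2 * (2 * (1 / (1 - q) ^ 3) - 1 / (1 - q) ^ 2) = 2 * (1 - q)⁻¹ - 1 := by
      rw [mul_sub, mul_one_div_cancel (pow_ne_zero _ ha), ← mul_assoc,
        (Commute.ofNat_right ((1 - q) ^ 2) 2).eq, mul_assoc,
        one_div, pow_succ' (1 - q) 2, mul_inv_rev, mul_inv_cancel_left₀ (pow_ne_zero _ ha)]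
    rw [e1, e2]
    exact koebe_re hq

theorem bohr_slice_starlike_sharp (r : ℝ) (hr1 : (3 - Real.sqrt 5) / 2 < r) (hr2 : r < 1) :
    ∃ (p : ℕ → ℍ[ℝ]) (q : ℍ[ℝ]), SliceStarlike p ∧ ‖q‖ = r ∧
      1 < ‖q‖ + ∑' k : ℕ, ‖q‖ ^ (k + 2) * ‖p (k + 2)‖ := by
  have h5 : Real.sqrt 5 ^ 2 = 5 := Real.sq_sqrt (by norm_num)
  have h50 := Real.sqrt_nonneg 5
  have h53 : Real.sqrt 5 < 3 := by nlinarith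
  have hr0 : 0 < r := by linarith
  have hnr : ‖(r : ℍ[ℝ])‖ = r := by rw [Quaternion.norm_coe, Real.norm_of_nonneg hr0.le]
  refine ⟨fun k => (k : ℍ[ℝ]), (r : ℍ[ℝ]), koebe_starlike, hnr, ?_⟩
  rw [hnr]
  have hs : HasSum (fun n : ℕ => (n : ℝ) * r ^ n) (r / (1 - r) ^ 2) :=
    hasSum_coe_mul_geometric_of_norm_lt_one (by rwa [Real.norm_of_nonneg hr0.le])
  have ht := hs.summable.sum_add_tsum_nat_add 2
  rw [hs.tsum_eq] at ht
  simp only [Finset.sum_range_succ, Finset.sum_range_zero] at ht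
  have hc : ∀ k : ℕ, r ^ (k + 2) * ‖((k + 2 : ℕ) : ℍ[ℝ])‖ = ((k + 2 : ℕ) : ℝ) * r ^ (k + 2) := by
    intro k
    rw [← Quaternion.coe_natCast, Quaternion.norm_coe, Real.norm_natCast, mul_comm]
  simp only [hc]
  have hf : 1 < r / (1 - r) ^ 2 := by
    rw [lt_div_iff₀ (by have : 0 < 1 - r := by linarith
                        positivity)]
    nlinarith
  have : r + ∑' k : ℕ, ((k + 2 : ℕ) : ℝ) * r ^ (k + 2) = r / (1 - r) ^ 2 := by
    rw [← ht]; simp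
  rw [this]
  exact hf
end
end

section
/- If f(q) = q + ∑_{k=2}^∞ qᵏ pₖ belongs to the class C of slice close-to-convex functions on the open unit ball 𝔹 of the quaternions, then |q| + ∑_{k=2}^∞ |q|ᵏ |pₖ| ≤ 1 for every q ∈ 𝔹 with |q| ≤ (3 − √5)/2. -/
noncomputable section
open scoped Quaternion

/-- The class `C` of slice close-to-convex functions. -/
def SliceCloseToConvex (p : ℕ → ℍ[ℝ]) : Prop :=
  SliceRegOn p ∧ p 0 = 0 ∧ p 1 = 1 ∧
    ∃ h : ℕ → ℍ[ℝ], SliceStarlike h ∧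
      ∀ q : ℍ[ℝ], ‖q‖ < 1 → q ≠ 0 → 0 < ((sliceVal h q)⁻¹ * q * sliceDeriv p q).re

lemma bohr_carath_r (φ : ℂ → ℂ) (hd : DifferentiableOn ℂ φ (Metric.ball 0 1))
    (hre : ∀ z ∈ Metric.ball (0:ℂ) 1, 0 ≤ (φ z).re) (h0 : φ 0 = 1) (n : ℕ) (hn : 1 ≤ n)
    (r : ℝ) (hr0 : 0 < r) (hr1 : r < 1) :
    r ^ n * ‖((n.factorial : ℂ))⁻¹ * iteratedDeriv n φ 0‖ ≤ 2 := by
  set e : ℂ := ((n.factorial : ℂ))⁻¹ * iteratedDeriv n φ 0 with he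
  by_cases hez : e = 0
  · rw [hez]; simp
  have hnpos : 0 < ‖e‖ := norm_pos_iff.mpr hez
  have hsub : Metric.closedBall (0:ℂ) r ⊆ Metric.ball 0 1 := Metric.closedBall_subset_ball hr1
  have hdr : DifferentiableOn ℂ φ (Metric.closedBall 0 r) := hd.mono hsub
  have hcs : ContinuousOn φ (Metric.sphere 0 r) :=
    hdr.continuousOn.mono Metric.sphere_subset_closedBall
  have hzne : ∀ z ∈ Metric.sphere (0:ℂ) r, z ≠ 0 := by
    rintro z hz rfl
    simp at hz; linarith
  -- averages
  have mean : ∀ F : ℂ → ℂ, DifferentiableOn ℂ F (Metric.closedBall 0 r) →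
      Real.circleAverage F 0 r = F 0 := by
    intro F hF
    apply DiffContOnCl.circleAverage
    rw [abs_of_pos hr0]
    exact (hF.mono Metric.closure_ball_subset_closedBall).diffContOnCl
  have A1 : Real.circleAverage (fun z => 2 * φ z) 0 r = 2 := by
    rw [mean _ (hdr.const_mul 2), h0]; simp
  have A2 : ∀ μ : ℂ, Real.circleAverage (fun z => μ * z ^ n * φ z) 0 r = 0 := by
    intro μ
    rw [mean (fun z => μ * z ^ n * φ z) (by fun_prop)]
    simp [show n ≠ 0 by omega]
  have A3 : ∀ κ : ℂ, Real.circleAverage (fun z => κ * (z ^ n)⁻¹ * φ z) 0 r = κ * e := by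
    intro κ
    rw [Real.circleAverage_eq_circleIntegral hr0.ne']
    have := hdr.circleIntegral_one_div_sub_center_pow_smul hr0 n
    have h2 : (∮ z in C(0, r), (z - 0)⁻¹ • (κ * (z ^ n)⁻¹ * φ z)) =
        κ • ∮ z in C(0, r), (1 / (z - 0) ^ (n + 1)) • φ z := by
      rw [← circleIntegral.integral_smul]
      congr 1; ext z
      simp only [sub_zero, smul_eq_mul, pow_succ, one_div, mul_inv]; ring
    rw [h2, this, he]
    have := Complex.two_pi_I_ne_zero
    simp only [smul_eq_mul]
    field_simp
  set μ : ℂ := -(e / (‖e‖ * r ^ n : ℝ)) with hμ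
  have hμn : ‖μ‖ * r ^ n = 1 := by
    rw [hμ, norm_neg, norm_div, Complex.norm_real, Real.norm_of_nonneg (by positivity)]
    field_simp
  set κ : ℂ := (starRingEnd ℂ) μ * (r ^ (2 * n) : ℝ) with hκ
  have I1 : CircleIntegrable (fun z => 2 * φ z) 0 r :=
    ContinuousOn.circleIntegrable hr0.le (by fun_prop)
  have I2 : CircleIntegrable (fun z => μ * z ^ n * φ z) 0 r :=
    ContinuousOn.circleIntegrable hr0.le (by fun_prop)
  have I3 : CircleIntegrable (fun z => κ * (z ^ n)⁻¹ * φ z) 0 r := by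
    apply ContinuousOn.circleIntegrable hr0.le
    refine ContinuousOn.mul (continuousOn_const.mul (ContinuousOn.inv₀ (by fun_prop) ?_)) hcs
    intro z hz; exact pow_ne_zero _ (hzne z hz)
  have A : Real.circleAverage (fun z => 2 * φ z + μ * z ^ n * φ z + κ * (z ^ n)⁻¹ * φ z) 0 r
      = 2 + κ * e := by
    rw [Real.circleAverage_fun_add (f₁ := fun z => 2 * φ z + μ * z ^ n * φ z) (I1.add I2) I3,
      Real.circleAverage_fun_add I1 I2, A1, A2, A3, add_zero]
  have B := Complex.reCLM.circleAverage_comp_comm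
    (f := fun z => 2 * φ z + μ * z ^ n * φ z + κ * (z ^ n)⁻¹ * φ z) ((I1.add I2).add I3)
  rw [A] at B
  have C : 0 ≤ Real.circleAverage (⇑Complex.reCLM ∘
      fun z => 2 * φ z + μ * z ^ n * φ z + κ * (z ^ n)⁻¹ * φ z) 0 r := by
    apply Real.circleAverage_nonneg_of_nonneg
    intro z hz
    rw [abs_of_pos hr0] at hz
    have hz' : ‖z‖ = r := by simpa using hz
    have hp := hre z (hsub (Metric.sphere_subset_closedBall hz))
    have e1 : κ * (z ^ n)⁻¹ = (starRingEnd ℂ) (μ * z ^ n) := by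
      have hzn : z ^ n ≠ 0 := pow_ne_zero _ (hzne z hz)
      rw [hκ, map_mul]
      have : ((r ^ (2 * n) : ℝ) : ℂ) = (starRingEnd ℂ) (z ^ n) * z ^ n := by
        rw [← Complex.normSq_eq_conj_mul_self, Complex.normSq_eq_norm_sq, norm_pow, hz']
        push_cast; ring
      rw [this]; field_simp
    have e2 : 2 * φ z + μ * z ^ n * φ z + κ * (z ^ n)⁻¹ * φ z
        = ((2 + 2 * (μ * z ^ n).re : ℝ) : ℂ) * φ z := by
      rw [e1]
      have := Complex.add_conj (μ * z ^ n)
      push_cast at this ⊢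
      linear_combination φ z * this
    simp only [Function.comp, Complex.reCLM_apply]
    rw [e2, Complex.re_ofReal_mul]
    apply mul_nonneg _ hp
    have := Complex.abs_re_le_norm (μ * z ^ n)
    rw [norm_mul, norm_pow, hz', hμn] at this
    have := (abs_le.mp this).1
    linarith
  rw [B] at C
  have D : κ * e = ((-(r ^ n * ‖e‖) : ℝ) : ℂ) := by
    rw [hκ, hμ, map_neg, map_div₀, Complex.conj_ofReal]
    have : (starRingEnd ℂ) e * e = ((‖e‖ ^ 2 : ℝ) : ℂ) := by
      rw [← Complex.normSq_eq_conj_mul_self, Complex.normSq_eq_norm_sq]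
    have hh : (‖e‖ : ℂ) ≠ 0 := by exact_mod_cast hnpos.ne'
    have hr : (r : ℂ) ≠ 0 := by exact_mod_cast hr0.ne'
    push_cast at this ⊢
    field_simp
    linear_combination (-(r:ℂ)^(2*n)) * this
  rw [D] at C
  simp only [Complex.reCLM_apply, Complex.add_re, Complex.ofReal_re, Complex.re_ofNat] at C
  linarith

lemma bohr_carath (φ : ℂ → ℂ) (hd : DifferentiableOn ℂ φ (Metric.ball 0 1))
    (hre : ∀ z ∈ Metric.ball (0:ℂ) 1, 0 ≤ (φ z).re) (h0 : φ 0 = 1) (n : ℕ) (hn : 1 ≤ n) :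
    ‖((n.factorial : ℂ))⁻¹ * iteratedDeriv n φ 0‖ ≤ 2 := by
  set E := ‖((n.factorial : ℂ))⁻¹ * iteratedDeriv n φ 0‖
  have ht : Filter.Tendsto (fun r : ℝ => r ^ n * E) (nhdsWithin 1 (Set.Iio 1)) (nhds (1 ^ n * E)) :=
    tendsto_nhdsWithin_of_tendsto_nhds (Continuous.tendsto (by fun_prop) 1)
  rw [one_pow, one_mul] at ht
  refine le_of_tendsto ht ?_
  filter_upwards [Ioo_mem_nhdsLT (show (0:ℝ) < 1 by norm_num)] with r hr
  exact bohr_carath_r φ hd hre h0 n hn r hr.1 hr.2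

/-- good power series -/
def BohrGood (a : PowerSeries ℂ) : Prop :=
  ∀ r : ℝ, 0 ≤ r → r < 1 → Summable fun n : ℕ => r ^ n * ‖PowerSeries.coeff n a‖

noncomputable def bohrPv (a : PowerSeries ℂ) (z : ℂ) : ℂ := ∑' n : ℕ, z ^ n * PowerSeries.coeff n a

lemma BohrGood.norm {a : PowerSeries ℂ} (ha : BohrGood a) {z : ℂ} (hz : ‖z‖ < 1) :
    Summable fun n : ℕ => ‖z ^ n * PowerSeries.coeff n a‖ := by
  simpa [norm_mul, norm_pow] using ha ‖z‖ (norm_nonneg _) hz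

lemma BohrGood.hasSum {a : PowerSeries ℂ} (ha : BohrGood a) {z : ℂ} (hz : ‖z‖ < 1) :
    HasSum (fun n : ℕ => z ^ n * PowerSeries.coeff n a) (bohrPv a z) :=
  (ha.norm hz).of_norm.hasSum

lemma BohrGood.add {a b : PowerSeries ℂ} (ha : BohrGood a) (hb : BohrGood b) : BohrGood (a + b) := by
  intro r h0 h1
  refine Summable.of_nonneg_of_le (fun n => by positivity) (fun n => ?_) ((ha r h0 h1).add (hb r h0 h1))
  rw [← mul_add, map_add]
  gcongr
  exact norm_add_le _ _

lemma bohrPv_add {a b : PowerSeries ℂ} (ha : BohrGood a) (hb : BohrGood b) {z : ℂ} (hz : ‖z‖ < 1) :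
    bohrPv (a + b) z = bohrPv a z + bohrPv b z := by
  refine HasSum.tsum_eq ?_
  simpa [mul_add] using (ha.hasSum hz).add (hb.hasSum hz)

lemma bohr_term {a b : PowerSeries ℂ} (z : ℂ) (n : ℕ) :
    z ^ n * PowerSeries.coeff n (a * b) = ∑ x ∈ Finset.HasAntidiagonal.antidiagonal n,
      (z ^ x.1 * PowerSeries.coeff x.1 a) * (z ^ x.2 * PowerSeries.coeff x.2 b) := by
  rw [PowerSeries.coeff_mul, Finset.mul_sum]
  refine Finset.sum_congr rfl fun x hx => ?_
  rw [← Finset.HasAntidiagonal.mem_antidiagonal.mp hx, pow_add]; ring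

lemma BohrGood.mul {a b : PowerSeries ℂ} (ha : BohrGood a) (hb : BohrGood b) : BohrGood (a * b) := by
  intro r h0 h1
  have hz : ‖(r : ℂ)‖ < 1 := by simpa [abs_of_nonneg h0] using h1
  have := summable_norm_sum_mul_antidiagonal_of_summable_norm (ha.norm hz) (hb.norm hz)
  simp_rw [← bohr_term] at this
  simpa [abs_of_nonneg h0] using this

lemma bohrPv_mul {a b : PowerSeries ℂ} (ha : BohrGood a) (hb : BohrGood b) {z : ℂ} (hz : ‖z‖ < 1) :
    bohrPv (a * b) z = bohrPv a z * bohrPv b z := by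
  unfold bohrPv
  rw [tsum_mul_tsum_eq_tsum_sum_antidiagonal_of_summable_norm (ha.norm hz) (hb.norm hz)]
  simp_rw [← bohr_term]

lemma BohrGood.conj {a : PowerSeries ℂ} (ha : BohrGood a) :
    BohrGood (PowerSeries.map (starRingEnd ℂ) a) := by
  intro r h0 h1
  simpa using ha r h0 h1

lemma BohrGood.diff {a : PowerSeries ℂ} (ha : BohrGood a) :
    DifferentiableOn ℂ (bohrPv a) (Metric.ball 0 1) := by
  intro z hz
  have hz : ‖z‖ < 1 := by simpa using hz
  obtain ⟨r, hr, hr1⟩ := exists_between hz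
  have h0 : 0 ≤ r := (norm_nonneg _).trans hr.le
  have := Complex.differentiableOn_tsum_of_summable_norm (U := Metric.ball (0:ℂ) r)
    (F := fun n z => z ^ n * PowerSeries.coeff n a) (ha r h0 hr1)
    (fun n => by fun_prop) Metric.isOpen_ball (by
      intro n w hw
      have hw : ‖w‖ < r := by simpa using hw
      rw [norm_mul, norm_pow]; gcongr)
  exact ((this z (by simpa using hr)).differentiableAt
    (Metric.isOpen_ball.mem_nhds (by simpa using hr))).differentiableWithinAt

lemma bohr_uniq {a b : PowerSeries ℂ} (ha : BohrGood a) (hb : BohrGood b)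
    (h : ∀ z : ℂ, ‖z‖ < 1 → bohrPv a z = bohrPv b z) : a = b := by
  have key : ∀ c : PowerSeries ℂ, BohrGood c → (∀ z : ℂ, ‖z‖ < 1 → bohrPv a z = bohrPv c z) →
      HasFPowerSeriesAt (bohrPv a) (FormalMultilinearSeries.ofScalars ℂ
        (fun n => PowerSeries.coeff n c)) 0 := by
    intro c hc hac
    rw [hasFPowerSeriesAt_iff]
    filter_upwards [Metric.ball_mem_nhds (0:ℂ) one_pos] with z hz
    have hz : ‖z‖ < 1 := by simpa using hz
    rw [zero_add, hac z hz]
    simpa [FormalMultilinearSeries.coeff_ofScalars] using hc.hasSum hz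
  have := (key a ha (fun _ _ => rfl)).eq_formalMultilinearSeries (key b hb h)
  ext n
  have h2 := congrArg (fun p => p.coeff n) this
  simpa [FormalMultilinearSeries.coeff_ofScalars] using h2

/-- quotient lemma -/
lemma bohr_quot {D N s : PowerSeries ℂ} (hD : BohrGood D) (hN : BohrGood N)
    (hs : D * s = N) (hne : ∀ z : ℂ, ‖z‖ < 1 → bohrPv D z ≠ 0)
    (hpos : ∀ z : ℂ, ‖z‖ < 1 → 0 ≤ (bohrPv N z / bohrPv D z).re)
    (h0 : bohrPv N 0 / bohrPv D 0 = 1) (n : ℕ) (hn : 1 ≤ n) : ‖PowerSeries.coeff n s‖ ≤ 2 := by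
  set φ : ℂ → ℂ := fun z => bohrPv N z / bohrPv D z with hφ
  have hd : DifferentiableOn ℂ φ (Metric.ball 0 1) :=
    hN.diff.div hD.diff (fun z hz => hne z (by simpa using hz))
  set e : PowerSeries ℂ := PowerSeries.mk fun n => ((n.factorial : ℂ))⁻¹ * iteratedDeriv n φ 0 with he
  have hsum : ∀ z : ℂ, ‖z‖ < 1 → HasSum (fun n : ℕ => z ^ n * PowerSeries.coeff n e) (φ z) := by
    intro z hz
    have := Complex.hasSum_taylorSeries_on_ball hd (z := z) (by simpa using hz)
    refine (congrArg (HasSum · (φ z)) (funext fun m => ?_)).mpr this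
    simp only [he, PowerSeries.coeff_mk, sub_zero, smul_eq_mul]; ring
  have hge : BohrGood e := by
    intro r h0 h1
    have hz : ‖(r : ℂ)‖ < 1 := by simpa [abs_of_nonneg h0] using h1
    have := (hsum r hz).summable.norm
    simpa [abs_of_nonneg h0] using this
  have hee : D * e = N := by
    apply bohr_uniq (hD.mul hge) hN
    intro z hz
    rw [bohrPv_mul hD hge hz, show bohrPv e z = φ z from (hsum z hz).tsum_eq, hφ]
    exact mul_div_cancel₀ _ (hne z hz)
  have hDne : D ≠ 0 := by
    rintro rfl
    exact hne 0 (by simp) (by simp [bohrPv])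
  have : s = e := mul_left_cancel₀ hDne (hs.trans hee.symm)
  rw [this, he, PowerSeries.coeff_mk]
  exact bohr_carath φ hd (fun z hz => hpos z (by simpa using hz)) h0 n hn

noncomputable def bohrMk (x y : ℂ) : ℍ[ℝ] := ⟨x.re, x.im, y.re, y.im⟩
noncomputable def bohrFst (q : ℍ[ℝ]) : ℂ := ⟨q.re, q.imI⟩
noncomputable def bohrSnd (q : ℍ[ℝ]) : ℂ := ⟨q.imJ, q.imK⟩
noncomputable def bohrA (h : ℕ → ℍ[ℝ]) : PowerSeries ℂ := PowerSeries.mk fun n => bohrFst (h n)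
noncomputable def bohrB (h : ℕ → ℍ[ℝ]) : PowerSeries ℂ := PowerSeries.mk fun n => bohrSnd (h n)
noncomputable def bohrConj (a : PowerSeries ℂ) : PowerSeries ℂ := PowerSeries.map (starRingEnd ℂ) a

@[simp] lemma bohrMk_re (x y : ℂ) : (bohrMk x y).re = x.re := rfl
@[simp] lemma bohrMk_imI (x y : ℂ) : (bohrMk x y).imI = x.im := rfl
@[simp] lemma bohrMk_imJ (x y : ℂ) : (bohrMk x y).imJ = y.re := rfl
@[simp] lemma bohrMk_imK (x y : ℂ) : (bohrMk x y).imK = y.im := rfl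

lemma BohrGood.conj' {a : PowerSeries ℂ} (ha : BohrGood a) : BohrGood (bohrConj a) := ha.conj

lemma bohrMk_mul (a b c d : ℂ) : bohrMk a b * bohrMk c d =
    bohrMk (a * c - b * (starRingEnd ℂ) d) (a * d + b * (starRingEnd ℂ) c) := by
  ext <;> simp <;> ring

lemma bohrMk_eta (q : ℍ[ℝ]) : bohrMk (bohrFst q) (bohrSnd q) = q := by
  ext <;> simp [bohrFst, bohrSnd]

lemma bohrMk_eq (x y : ℂ) : bohrMk x y =
    Quaternion.ofComplex x + Quaternion.ofComplex y * bohrMk 0 1 := by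
  ext <;> simp [Quaternion.coe_ofComplex]

lemma bohrMk_zero_iff (x y : ℂ) : bohrMk x y = 0 ↔ x = 0 ∧ y = 0 := by
  constructor
  · intro h
    have h1 := congrArg (fun q : ℍ[ℝ] => q.re) h
    have h2 := congrArg (fun q : ℍ[ℝ] => q.imI) h
    have h3 := congrArg (fun q : ℍ[ℝ] => q.imJ) h
    have h4 := congrArg (fun q : ℍ[ℝ] => q.imK) h
    simp at h1 h2 h3 h4
    exact ⟨Complex.ext h1 h2, Complex.ext h3 h4⟩
  · rintro ⟨rfl, rfl⟩
    ext <;> simp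

lemma bohrMk_pow (z : ℂ) (n : ℕ) : bohrMk z 0 ^ n = bohrMk (z ^ n) 0 := by
  have h : ∀ x, bohrMk x 0 = Quaternion.ofComplex x := by intro x; rw [bohrMk_eq]; simp
  rw [h, h, map_pow]

lemma bohrMk_normSq (x y : ℂ) : ‖bohrMk x y‖ ^ 2 = ‖x‖ ^ 2 + ‖y‖ ^ 2 := by
  rw [pow_two, ← Quaternion.normSq_eq_norm_mul_self, Quaternion.normSq_def',
    ← Complex.normSq_eq_norm_sq, ← Complex.normSq_eq_norm_sq, Complex.normSq_apply, Complex.normSq_apply]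
  simp; ring

lemma bohrMk_norm (z : ℂ) : ‖bohrMk z 0‖ = ‖z‖ := by
  have := bohrMk_normSq z 0
  rw [norm_zero] at this
  have h2 : ‖bohrMk z 0‖ ^ 2 = ‖z‖ ^ 2 := by rw [this]; ring
  exact (pow_left_inj₀ (norm_nonneg _) (norm_nonneg _) two_ne_zero).mp h2

lemma bohrFst_norm_le (q : ℍ[ℝ]) : ‖bohrFst q‖ ≤ ‖q‖ := by
  have := bohrMk_normSq (bohrFst q) (bohrSnd q)
  rw [bohrMk_eta] at this
  exact (pow_le_pow_iff_left₀ (norm_nonneg _) (norm_nonneg _) two_ne_zero).mp (by nlinarith [sq_nonneg ‖bohrSnd q‖])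

lemma bohrSnd_norm_le (q : ℍ[ℝ]) : ‖bohrSnd q‖ ≤ ‖q‖ := by
  have := bohrMk_normSq (bohrFst q) (bohrSnd q)
  rw [bohrMk_eta] at this
  exact (pow_le_pow_iff_left₀ (norm_nonneg _) (norm_nonneg _) two_ne_zero).mp (by nlinarith [sq_nonneg ‖bohrFst q‖])

lemma bohrMk_hasSum {f g : ℕ → ℂ} {x y : ℂ} (hf : HasSum f x) (hg : HasSum g y) :
    HasSum (fun n => bohrMk (f n) (g n)) (bohrMk x y) := by
  rw [bohrMk_eq, show (fun n => bohrMk (f n) (g n)) = fun n => Quaternion.ofComplex (f n) +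
    Quaternion.ofComplex (g n) * bohrMk 0 1 from funext fun n => bohrMk_eq _ _]
  have hc : Continuous (Quaternion.ofComplex) :=
    (Quaternion.ofComplex.toLinearMap).continuous_of_finiteDimensional
  exact (hf.map Quaternion.ofComplex hc).add ((hg.map Quaternion.ofComplex hc).mul_right _)

lemma bohr_reg_summable {h : ℕ → ℍ[ℝ]} (hs : SliceRegOn h) {r : ℝ} (h0 : 0 ≤ r) (h1 : r < 1) :
    Summable fun n : ℕ => r ^ n * ‖h n‖ := by
  have := (hs (r : ℍ[ℝ]) (by simpa [abs_of_nonneg h0] using h1)).norm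
  simpa [abs_of_nonneg h0] using this

lemma bohrA_good {h : ℕ → ℍ[ℝ]} (hs : SliceRegOn h) : BohrGood (bohrA h) := by
  intro r h0 h1
  refine Summable.of_nonneg_of_le (fun n => by positivity) (fun n => ?_) (bohr_reg_summable hs h0 h1)
  rw [bohrA, PowerSeries.coeff_mk]
  gcongr
  exact bohrFst_norm_le _

lemma bohrB_good {h : ℕ → ℍ[ℝ]} (hs : SliceRegOn h) : BohrGood (bohrB h) := by
  intro r h0 h1
  refine Summable.of_nonneg_of_le (fun n => by positivity) (fun n => ?_) (bohr_reg_summable hs h0 h1)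
  rw [bohrB, PowerSeries.coeff_mk]
  gcongr
  exact bohrSnd_norm_le _

lemma bohr_conj_pow (w q : ℍ[ℝ]) (hw : w ≠ 0) (n : ℕ) : (w⁻¹ * q * w) ^ n = w⁻¹ * q ^ n * w := by
  induction n with
  | zero => simp [hw]
  | succ n ih =>
    rw [pow_succ, ih, pow_succ]
    have : w * w⁻¹ = 1 := mul_inv_cancel₀ hw
    calc w⁻¹ * q ^ n * w * (w⁻¹ * q * w) = w⁻¹ * q ^ n * (w * w⁻¹) * q * w := by noncomm_ring
      _ = _ := by rw [this]; noncomm_ring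

lemma bohr_val {h : ℕ → ℍ[ℝ]} (hs : SliceRegOn h) {z : ℂ} (hz : ‖z‖ < 1) (α β : ℂ)
    (hw : bohrMk α β ≠ 0) :
    sliceVal h ((bohrMk α β)⁻¹ * bohrMk z 0 * bohrMk α β) = (bohrMk α β)⁻¹ *
      bohrMk (α * bohrPv (bohrA h) z - β * bohrPv (bohrConj (bohrB h)) z)
        (α * bohrPv (bohrB h) z + β * bohrPv (bohrConj (bohrA h)) z) := by
  have hA := (bohrA_good hs).hasSum hz
  have hB := (bohrB_good hs).hasSum hz
  have hA' := (bohrA_good hs).conj'.hasSum hz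
  have hB' := (bohrB_good hs).conj'.hasSum hz
  have := (bohrMk_hasSum ((hA.mul_left α).sub (hB'.mul_left β))
    ((hB.mul_left α).add (hA'.mul_left β))).mul_left (bohrMk α β)⁻¹
  refine HasSum.tsum_eq ((congrArg (HasSum · _) (funext fun n => ?_)).mpr this)
  rw [bohr_conj_pow _ _ hw, bohrMk_pow, mul_assoc, mul_assoc]
  congr 1
  nth_rewrite 1 [← bohrMk_eta (h n)]
  rw [bohrMk_mul, bohrMk_mul]
  simp only [bohrConj, bohrA, bohrB, PowerSeries.coeff_map, PowerSeries.coeff_mk]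
  congr 1 <;> simp <;> ring

lemma bohr_conj_norm (w q : ℍ[ℝ]) (hw : w ≠ 0) : ‖w⁻¹ * q * w‖ = ‖q‖ := by
  rw [norm_mul, norm_mul, norm_inv]
  have : ‖w‖ ≠ 0 := norm_ne_zero_iff.mpr hw
  field_simp

lemma bohr_key_complex (h g P : ℕ → ℍ[ℝ]) (hs : SliceRegOn h) (gs : SliceRegOn g)
    (h0 : h 0 = 1) (g0 : g 0 = 1)
    (hne : ∀ q : ℍ[ℝ], ‖q‖ < 1 → sliceVal h q ≠ 0)
    (pos : ∀ q : ℍ[ℝ], ‖q‖ < 1 → 0 ≤ ((sliceVal h q)⁻¹ * sliceVal g q).re)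
    (hP : ∀ n, ∑ x ∈ Finset.HasAntidiagonal.antidiagonal n, h x.1 * P x.2 = g n)
    (n : ℕ) (hn : 1 ≤ n) : ‖bohrFst (P n)‖ ≤ 2 := by
  set a := bohrA h with ha
  set b := bohrB h with hb
  set c := bohrA g with hc
  set d := bohrB g with hd
  set s := bohrA P with hs'
  set t := bohrB P with ht'
  have ga : BohrGood a := bohrA_good hs
  have gb : BohrGood b := bohrB_good hs
  have gc : BohrGood c := bohrA_good gs
  have gd : BohrGood d := bohrB_good gs
  have E1 : a * s - b * bohrConj t = c := by
    ext m
    rw [map_sub, PowerSeries.coeff_mul, PowerSeries.coeff_mul, ← Finset.sum_sub_distrib]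
    simp only [ha, hb, hc, hs', ht', bohrA, bohrB, bohrConj, PowerSeries.coeff_map, PowerSeries.coeff_mk]
    rw [← hP m]
    have : bohrFst (∑ x ∈ Finset.HasAntidiagonal.antidiagonal m, h x.1 * P x.2) =
        ∑ x ∈ Finset.HasAntidiagonal.antidiagonal m, bohrFst (h x.1 * P x.2) :=
      map_sum (AddMonoidHom.mk' bohrFst (by intro x y; apply Complex.ext <;> simp [bohrFst])) _ _
    rw [this]
    refine Finset.sum_congr rfl fun x _ => ?_
    apply Complex.ext <;> simp [bohrFst, bohrSnd] <;> ring
  have E2 : a * t + b * bohrConj s = d := by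
    ext m
    rw [map_add, PowerSeries.coeff_mul, PowerSeries.coeff_mul, ← Finset.sum_add_distrib]
    simp only [ha, hb, hd, hs', ht', bohrA, bohrB, bohrConj, PowerSeries.coeff_map, PowerSeries.coeff_mk]
    rw [← hP m]
    have : bohrSnd (∑ x ∈ Finset.HasAntidiagonal.antidiagonal m, h x.1 * P x.2) =
        ∑ x ∈ Finset.HasAntidiagonal.antidiagonal m, bohrSnd (h x.1 * P x.2) :=
      map_sum (AddMonoidHom.mk' bohrSnd (by intro x y; apply Complex.ext <;> simp [bohrSnd])) _ _
    rw [this]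
    refine Finset.sum_congr rfl fun x _ => ?_
    apply Complex.ext <;> simp [bohrFst, bohrSnd] <;> ring
  have cc : ∀ x : PowerSeries ℂ, bohrConj (bohrConj x) = x := by
    intro x; ext m; simp [bohrConj]
  have E3 : bohrConj a * bohrConj t + bohrConj b * s = bohrConj d := by
    rw [← E2]
    have : bohrConj (bohrConj s) = s := cc s
    conv_lhs => rw [← this]
    simp [bohrConj]
  set D := bohrConj a * a + b * bohrConj b with hD
  set N := bohrConj a * c + b * bohrConj d with hN
  have gD : BohrGood D := (ga.conj'.mul ga).add (gb.mul gb.conj')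
  have gN : BohrGood N := (ga.conj'.mul gc).add (gb.mul gd.conj')
  have hDs : D * s = N := by
    rw [hN, ← E3, ← E1, hD]; ring
  have vD : ∀ z : ℂ, ‖z‖ < 1 → bohrPv D z = bohrPv (bohrConj a) z * bohrPv a z
      + bohrPv b z * bohrPv (bohrConj b) z := by
    intro z hz
    rw [hD, bohrPv_add (BohrGood.mul ga.conj' ga) (BohrGood.mul gb gb.conj') hz]
    congr 1
    · exact bohrPv_mul ga.conj' ga hz
    · exact bohrPv_mul gb gb.conj' hz
  have vN : ∀ z : ℂ, ‖z‖ < 1 → bohrPv N z = bohrPv (bohrConj a) z * bohrPv c z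
      + bohrPv b z * bohrPv (bohrConj d) z := by
    intro z hz
    rw [hN, bohrPv_add (BohrGood.mul ga.conj' gc) (BohrGood.mul gb gd.conj') hz]
    congr 1
    · exact bohrPv_mul ga.conj' gc hz
    · exact bohrPv_mul gb gd.conj' hz
  have hin : ∀ (z : ℂ) (w : ℍ[ℝ]), ‖z‖ < 1 → w ≠ 0 → ‖w⁻¹ * bohrMk z 0 * w‖ < 1 := by
    intro z w hz hw
    rwa [bohr_conj_norm _ _ hw, bohrMk_norm]
  have hDne : ∀ z : ℂ, ‖z‖ < 1 → bohrPv D z ≠ 0 := by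
    intro z hz hz0
    rw [vD z hz] at hz0
    by_cases c1 : bohrMk (bohrPv (bohrConj a) z) (-bohrPv b z) = 0
    · by_cases c2 : bohrMk (bohrPv (bohrConj b) z) (bohrPv a z) = 0
      · rw [bohrMk_zero_iff] at c1 c2
        have h1 : bohrMk 1 0 ≠ 0 := by rw [Ne, bohrMk_zero_iff]; simp
        apply hne _ (hin z _ hz h1)
        rw [bohr_val hs hz _ _ h1, ← ha, ← hb, c2.2, neg_eq_zero.mp c1.2]
        simp [(bohrMk_zero_iff 0 0).mpr]
      · apply hne _ (hin z _ hz c2)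
        rw [bohr_val hs hz _ _ c2, ← ha, ← hb, mul_eq_zero]
        right
        rw [bohrMk_zero_iff]
        refine ⟨by ring, by linear_combination hz0⟩
    · apply hne _ (hin z _ hz c1)
      rw [bohr_val hs hz _ _ c1, ← ha, ← hb, mul_eq_zero]
      right
      rw [bohrMk_zero_iff]
      refine ⟨by linear_combination hz0, by ring⟩
  have hpos : ∀ z : ℂ, ‖z‖ < 1 → 0 ≤ (bohrPv N z / bohrPv D z).re := by
    intro z hz
    have hd0 := hDne z hz
    have hw : bohrMk (bohrPv (bohrConj a) z) (-bohrPv b z) ≠ 0 := by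
      intro h
      rw [bohrMk_zero_iff, neg_eq_zero] at h
      apply hd0
      rw [vD z hz, h.1, h.2]; ring
    have hp := pos _ (hin z _ hz hw)
    rw [bohr_val hs hz _ _ hw, bohr_val gs hz _ _ hw, ← ha, ← hb, ← hc, ← hd] at hp
    set w := bohrMk (bohrPv (bohrConj a) z) (-bohrPv b z)
    rw [mul_inv_rev, inv_inv, mul_assoc, mul_inv_cancel_left₀ hw] at hp
    rw [show bohrPv (bohrConj a) z * bohrPv a z - -bohrPv b z * bohrPv (bohrConj b) z = bohrPv D z by
        rw [vD z hz]; ring,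
      show bohrPv (bohrConj a) z * bohrPv b z + -bohrPv b z * bohrPv (bohrConj a) z = 0 by ring,
      show bohrPv (bohrConj a) z * bohrPv c z - -bohrPv b z * bohrPv (bohrConj d) z = bohrPv N z by
        rw [vN z hz]; ring] at hp
    have hi : (bohrMk (bohrPv D z) 0)⁻¹ = bohrMk (bohrPv D z)⁻¹ 0 := by
      apply inv_eq_of_mul_eq_one_right
      rw [bohrMk_mul, mul_inv_cancel₀ hd0]
      ext <;> simp
    rw [hi, bohrMk_mul, bohrMk_re] at hp
    rw [div_eq_inv_mul]
    simpa using hp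
  have p0 : ∀ x : PowerSeries ℂ, bohrPv x 0 = PowerSeries.coeff 0 x := by
    intro x
    rw [bohrPv, tsum_eq_single 0]
    · simp
    · intro m hm; simp [hm]
  have f1 : bohrFst 1 = 1 := by apply Complex.ext <;> simp [bohrFst]
  have f2 : bohrSnd 1 = 0 := by apply Complex.ext <;> simp [bohrSnd]
  have hz0 : bohrPv N 0 / bohrPv D 0 = 1 := by
    rw [vN 0 (by simp), vD 0 (by simp)]
    simp only [p0, ha, hb, hc, hd, bohrConj, bohrA, bohrB, PowerSeries.coeff_map,
      PowerSeries.coeff_mk, h0, g0, f1, f2]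
    simp
  have := bohr_quot gD gN hDs hDne hpos hz0 n hn
  simpa [hs', bohrA] using this

lemma bohr_re_comm (x y : ℍ[ℝ]) : (x * y).re = (y * x).re := by
  simp; ring

lemma bohr_exists_conj (x : ℍ[ℝ]) : ∃ w : ℍ[ℝ], w ≠ 0 ∧ bohrSnd (w * x * w⁻¹) = 0 := by
  by_cases hx : x.imJ = 0 ∧ x.imK = 0
  · refine ⟨1, one_ne_zero, ?_⟩
    apply Complex.ext <;> simp [bohrSnd, hx.1, hx.2]
  · set s : ℝ := Real.sqrt (x.imI ^ 2 + x.imJ ^ 2 + x.imK ^ 2) with hs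
    have hss : s * s = x.imI ^ 2 + x.imJ ^ 2 + x.imK ^ 2 := Real.mul_self_sqrt (by positivity)
    set w : ℍ[ℝ] := bohrMk ⟨0, x.imI + s⟩ ⟨x.imJ, x.imK⟩ with hw
    have hw0 : w ≠ 0 := by
      intro h
      rw [hw, bohrMk_zero_iff] at h
      have h2 := h.2
      rw [Complex.ext_iff] at h2
      exact hx ⟨h2.1, h2.2⟩
    refine ⟨w, hw0, ?_⟩
    have : w * x = bohrMk ⟨x.re, s⟩ 0 * w := by
      ext <;> simp [hw] <;> nlinarith [hss]
    rw [this, mul_assoc, mul_inv_cancel₀ hw0, mul_one]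
    apply Complex.ext <;> simp [bohrSnd]

lemma bohr_conj_term (w q x : ℍ[ℝ]) (hw : w ≠ 0) (k : ℕ) :
    q ^ k * (w * x * w⁻¹) = w * ((w⁻¹ * q * w) ^ k * x) * w⁻¹ := by
  rw [bohr_conj_pow _ _ hw]
  simp only [mul_assoc]
  rw [mul_inv_cancel_left₀ hw]

lemma bohr_conj_reg {h : ℕ → ℍ[ℝ]} (hs : SliceRegOn h) (w : ℍ[ℝ]) (hw : w ≠ 0) :
    SliceRegOn fun k => w * h k * w⁻¹ := by
  intro q hq
  simp_rw [bohr_conj_term w q _ hw]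
  exact ((hs _ (by rwa [bohr_conj_norm _ _ hw])).mul_left w).mul_right _

lemma bohr_conj_val (h : ℕ → ℍ[ℝ]) (w q : ℍ[ℝ]) (hw : w ≠ 0) :
    sliceVal (fun k => w * h k * w⁻¹) q = w * sliceVal h (w⁻¹ * q * w) * w⁻¹ := by
  unfold sliceVal
  simp_rw [bohr_conj_term w q _ hw]
  rw [tsum_mul_right, tsum_mul_left]

lemma bohr_key (h g P : ℕ → ℍ[ℝ]) (hs : SliceRegOn h) (gs : SliceRegOn g)
    (h0 : h 0 = 1) (g0 : g 0 = 1)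
    (hne : ∀ q : ℍ[ℝ], ‖q‖ < 1 → sliceVal h q ≠ 0)
    (pos : ∀ q : ℍ[ℝ], ‖q‖ < 1 → 0 ≤ ((sliceVal h q)⁻¹ * sliceVal g q).re)
    (hP : ∀ n, ∑ x ∈ Finset.HasAntidiagonal.antidiagonal n, h x.1 * P x.2 = g n)
    (n : ℕ) (hn : 1 ≤ n) : ‖P n‖ ≤ 2 := by
  obtain ⟨w, hw, hwP⟩ := bohr_exists_conj (P n)
  have hwi : w⁻¹ ≠ 0 := inv_ne_zero hw
  have key := bohr_key_complex (fun k => w * h k * w⁻¹) (fun k => w * g k * w⁻¹)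
    (fun k => w * P k * w⁻¹) (bohr_conj_reg hs w hw) (bohr_conj_reg gs w hw)
    (by simp [h0, hw]) (by simp [g0, hw])
    (by
      intro q hq
      rw [bohr_conj_val h w q hw]
      exact mul_ne_zero (mul_ne_zero hw (hne _ (by rwa [bohr_conj_norm _ _ hw]))) hwi)
    (by
      intro q hq
      rw [bohr_conj_val h w q hw, bohr_conj_val g w q hw]
      have := pos (w⁻¹ * q * w) (by rwa [bohr_conj_norm _ _ hw])
      rw [mul_inv_rev, mul_inv_rev, inv_inv, bohr_re_comm]
      simp only [mul_assoc]
      rw [inv_mul_cancel_left₀ hw, bohr_re_comm]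
      simp only [mul_assoc] at this ⊢
      rw [inv_mul_cancel₀ hw, mul_one, bohr_re_comm]
      exact this)
    (by
      intro m
      rw [← hP m, Finset.mul_sum, Finset.sum_mul]
      refine Finset.sum_congr rfl fun x _ => ?_
      simp only [mul_assoc]
      rw [inv_mul_cancel_left₀ hw])
    n hn
  have e := bohrMk_normSq (bohrFst (w * P n * w⁻¹)) (bohrSnd (w * P n * w⁻¹))
  rw [bohrMk_eta, hwP, norm_zero] at e
  have e2 : ‖w * P n * w⁻¹‖ = ‖P n‖ := by
    have := bohr_conj_norm w⁻¹ (P n) hwi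
    rwa [inv_inv] at this
  rw [e2] at e
  have h1 := norm_nonneg (bohrFst (w * P n * w⁻¹))
  have h2 := norm_nonneg (P n)
  nlinarith

lemma bohr_coeff (h g : ℕ → ℍ[ℝ]) (hs : SliceRegOn h) (gs : SliceRegOn g)
    (h0 : h 0 = 1) (g0 : g 0 = 1)
    (hne : ∀ q : ℍ[ℝ], ‖q‖ < 1 → sliceVal h q ≠ 0)
    (pos : ∀ q : ℍ[ℝ], ‖q‖ < 1 → 0 ≤ ((sliceVal h q)⁻¹ * sliceVal g q).re) (n : ℕ) :
    ‖g n - h n‖ ≤ ∑ k ∈ Finset.range n, 2 * ‖h k‖ := by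
  set H : PowerSeries ℍ[ℝ] := PowerSeries.mk h with hH
  set G : PowerSeries ℍ[ℝ] := PowerSeries.mk g with hG
  set Q : PowerSeries ℍ[ℝ] := PowerSeries.invOfUnit H 1 * G with hQ
  have hHQ : H * Q = G := by
    rw [hQ, ← mul_assoc, PowerSeries.mul_invOfUnit, one_mul]
    simp [hH, h0]
  have hP : ∀ n, ∑ x ∈ Finset.HasAntidiagonal.antidiagonal n, h x.1 * PowerSeries.coeff x.2 Q = g n := by
    intro n
    have := congrArg (PowerSeries.coeff n) hHQ
    rw [PowerSeries.coeff_mul] at this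
    simpa [hH, hG] using this
  have hP0 : PowerSeries.coeff 0 Q = 1 := by
    have := hP 0
    simpa [h0, g0] using this
  have hb := bohr_key h g (fun n => PowerSeries.coeff n Q) hs gs h0 g0 hne pos hP
  rw [← hP n, Finset.Nat.sum_antidiagonal_eq_sum_range_succ
    (fun i j => h i * PowerSeries.coeff j Q), Finset.sum_range_succ, Nat.sub_self, hP0, mul_one,
    add_sub_cancel_right]
  refine (norm_sum_le _ _).trans (Finset.sum_le_sum fun k hk => ?_)
  have hk : k < n := Finset.mem_range.mp hk
  rw [norm_mul, mul_comm]
  have := hb (n - k) (by omega)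
  gcongr

lemma bohr_sum_aux (n : ℕ) : ∑ k ∈ Finset.range n, 2 * ((k : ℝ) + 1) = n * (n + 1) := by
  induction n with
  | zero => simp
  | succ n ih => rw [Finset.sum_range_succ, ih]; push_cast; ring

lemma bohr_shift_reg {h : ℕ → ℍ[ℝ]} (hs : SliceRegOn h) : SliceRegOn fun k => h (k + 1) := by
  intro q hq
  by_cases hq0 : q = 0
  · subst hq0
    refine summable_of_ne_finset_zero (s := {0}) ?_
    intro b hb
    have : b ≠ 0 := by simpa using hb
    simp [this]
  · have := ((summable_nat_add_iff 1).mpr (hs q hq)).mul_left q⁻¹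
    refine this.congr fun k => ?_
    rw [pow_succ', mul_assoc, inv_mul_cancel_left₀ hq0]

lemma bohr_deriv_reg {h : ℕ → ℍ[ℝ]} (hs : SliceRegOn h) :
    SliceRegOn fun k => ((k : ℝ) + 1) • h (k + 1) := by
  intro q hq
  obtain ⟨ρ, hρ, hρ1⟩ := exists_between hq
  have hρ0 : 0 < ρ := (norm_nonneg _).trans_lt hρ
  have S := bohr_reg_summable (bohr_shift_reg hs) hρ0.le hρ1
  set M := ∑' n : ℕ, ρ ^ n * ‖h (n + 1)‖ with hM
  set t := ‖q‖ / ρ with ht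
  have ht0 : 0 ≤ t := by positivity
  have ht1 : t < 1 := (div_lt_one hρ0).mpr hρ
  have htn : ‖t‖ < 1 := by rwa [Real.norm_of_nonneg ht0]
  have S2 : Summable fun k : ℕ => ((k : ℝ) + 1) * t ^ k * M := by
    have a1 := summable_pow_mul_geometric_of_norm_lt_one 1 htn
    have a2 := summable_geometric_of_norm_lt_one htn
    refine ((a1.add a2).mul_right M).congr fun k => ?_
    ring
  refine Summable.of_norm (Summable.of_nonneg_of_le (fun k => norm_nonneg _) (fun k => ?_) S2)
  have hk : ρ ^ k * ‖h (k + 1)‖ ≤ M := S.le_tsum k (fun j _ => by positivity)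
  have e : ‖q ^ k * (((k : ℝ) + 1) • h (k + 1))‖ =
      ((k : ℝ) + 1) * t ^ k * (ρ ^ k * ‖h (k + 1)‖) := by
    rw [norm_mul, norm_pow, norm_smul, Real.norm_of_nonneg (by positivity), ht, div_pow]
    field_simp
  rw [e]
  gcongr

lemma bohr_val_zero (h : ℕ → ℍ[ℝ]) : sliceVal h 0 = h 0 := by
  rw [sliceVal, tsum_eq_single 0]
  · simp
  · intro m hm; simp [hm]

lemma bohr_val_shift {h : ℕ → ℍ[ℝ]} (hs : SliceRegOn h) (h0 : h 0 = 0) {q : ℍ[ℝ]} (hq : ‖q‖ < 1) :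
    sliceVal h q = q * sliceVal (fun k => h (k + 1)) q := by
  unfold sliceVal
  rw [(hs q hq).tsum_eq_zero_add, h0, mul_zero, zero_add, ← tsum_mul_left]
  simp_rw [pow_succ', mul_assoc]

/-- Coefficient estimate from the geometric hypotheses. -/
lemma bohr_main {h p : ℕ → ℍ[ℝ]} (hh : SliceStarlike h) (hp : SliceRegOn p) (hp1 : p 1 = 1)
    (pos : ∀ q : ℍ[ℝ], ‖q‖ < 1 → q ≠ 0 → 0 < ((sliceVal h q)⁻¹ * q * sliceDeriv p q).re) (n : ℕ) :
    ‖((n : ℝ) + 1) • p (n + 1) - h (n + 1)‖ ≤ ∑ k ∈ Finset.range n, 2 * ‖h (k + 1)‖ := by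
  obtain ⟨hs, h0, h1, hne, -⟩ := hh
  refine bohr_coeff (fun k => h (k + 1)) (fun k => ((k : ℝ) + 1) • p (k + 1)) (bohr_shift_reg hs)
    (bohr_deriv_reg hp) (by simpa using h1) (by simp [hp1]) ?_ ?_ n
  · intro q hq
    by_cases hq0 : q = 0
    · subst hq0
      rw [bohr_val_zero]; simp [h1]
    · intro hz
      apply hne q hq hq0
      rw [bohr_val_shift hs h0 hq, hz, mul_zero]
  · intro q hq
    by_cases hq0 : q = 0
    · subst hq0
      rw [bohr_val_zero, bohr_val_zero]; simp [h1, hp1]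
    · have := pos q hq hq0
      rw [bohr_val_shift hs h0 hq, mul_inv_rev, mul_assoc _ q⁻¹ q, inv_mul_cancel₀ hq0, mul_one] at this
      exact this.le

lemma bohr_starlike_coeff {h : ℕ → ℍ[ℝ]} (hh : SliceStarlike h) (n : ℕ) :
    ‖h (n + 1)‖ ≤ (n : ℝ) + 1 := by
  induction n using Nat.strong_induction_on with
  | _ n ih =>
    rcases Nat.eq_zero_or_pos n with rfl | hn
    · simp [hh.2.2.1]
    have := bohr_main hh hh.1 hh.2.2.1 hh.2.2.2.2 n
    have h2 : ∑ k ∈ Finset.range n, 2 * ‖h (k + 1)‖ ≤ n * (n + 1) := by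
      rw [← bohr_sum_aux]
      refine Finset.sum_le_sum fun k hk => ?_
      have := ih k (Finset.mem_range.mp hk)
      gcongr
    have e : ((n : ℝ) + 1) • h (n + 1) - h (n + 1) = (n : ℝ) • h (n + 1) := by
      rw [add_smul, one_smul, add_sub_cancel_right]
    rw [e, norm_smul, Real.norm_of_nonneg (by positivity)] at this
    have hn' : (0 : ℝ) < n := by exact_mod_cast hn
    exact le_of_mul_le_mul_left (this.trans h2) hn'

lemma bohr_ctc_coeff {p : ℕ → ℍ[ℝ]} (hf : SliceCloseToConvex p) (n : ℕ) :
    ‖p (n + 1)‖ ≤ (n : ℝ) + 1 := by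
  obtain ⟨hp, -, hp1, h, hh, pos⟩ := hf
  have := bohr_main hh hp hp1 pos n
  have h2 : ∑ k ∈ Finset.range n, 2 * ‖h (k + 1)‖ ≤ n * (n + 1) := by
    rw [← bohr_sum_aux]
    refine Finset.sum_le_sum fun k hk => ?_
    have := bohr_starlike_coeff hh k
    gcongr
  have h3 := norm_le_norm_add_norm_sub' (((n : ℝ) + 1) • p (n + 1)) (h (n + 1))
  have h4 := bohr_starlike_coeff hh n
  rw [norm_smul, Real.norm_of_nonneg (by positivity)] at h3
  have hn' : (0 : ℝ) < n + 1 := by positivity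
  refine le_of_mul_le_mul_left ?_ hn'
  nlinarith

theorem bohr_slice_close_to_convex (p : ℕ → ℍ[ℝ]) (hf : SliceCloseToConvex p)
    (q : ℍ[ℝ]) (hq : ‖q‖ < 1) (hqr : ‖q‖ ≤ (3 - Real.sqrt 5) / 2) :
    ‖q‖ + ∑' k : ℕ, ‖q‖ ^ (k + 2) * ‖p (k + 2)‖ ≤ 1 := by
  set r := ‖q‖ with hr
  have hr0 : 0 ≤ r := norm_nonneg _
  have hs := hasSum_coe_mul_geometric_of_norm_lt_one (r := r) (by rwa [Real.norm_of_nonneg hr0])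
  have hs2 := (hasSum_nat_add_iff' 2).mpr hs
  have hsp : Summable fun k : ℕ => r ^ (k + 2) * ‖p (k + 2)‖ :=
    (summable_nat_add_iff 2).mpr (bohr_reg_summable hf.1 hr0 hq)
  have hle : ∑' k : ℕ, r ^ (k + 2) * ‖p (k + 2)‖ ≤ _ :=
    hasSum_le (fun k => ?_) hsp.hasSum hs2
  · simp [Finset.sum_range_succ] at hle
    have hb : r / (1 - r) ^ 2 ≤ 1 := by
      have : 0 < 1 - r := by linarith
      rw [div_le_one (by positivity)]
      have h5 : Real.sqrt 5 ^ 2 = 5 := Real.sq_sqrt (by norm_num)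
      have h6 : 0 ≤ Real.sqrt 5 := Real.sqrt_nonneg _
      nlinarith
    linarith
  · have := bohr_ctc_coeff hf (k + 1)
    rw [mul_comm]
    gcongr
    push_cast at this ⊢
    linarith
end
end

section
/- Let m ∈ (0,2], let f(q) = ∑_{k=0}^∞ qᵏ pₖ belong to SB(𝔹), and for each k ≥ 1 let ωₖ ∈ SB_k(𝔹). Then |p₀|^m + ∑_{k=1}^∞ |ωₖ(q)| |pₖ| ≤ 1 for every q ∈ 𝔹 with |q| ≤ m/(2+m). -/
noncomputable section
open scoped Quaternion

/-- The class `SB(𝔹)` of slice regular self-maps of the unit ball. -/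
def SBClass (p : ℕ → ℍ[ℝ]) : Prop :=
  SliceRegOn p ∧ ∀ q : ℍ[ℝ], ‖q‖ < 1 → ‖sliceVal p q‖ < 1

/-- The class `SB_n(𝔹)`: members of `SB(𝔹)` whose Taylor coefficients of order
`0, …, n-1` vanish and whose `n`-th Taylor coefficient is nonzero. -/
def SBnClass (n : ℕ) (p : ℕ → ℍ[ℝ]) : Prop :=
  SBClass p ∧ (∀ j, j < n → p j = 0) ∧ p n ≠ 0


lemma bg_slice (v : ℍ[ℝ]) : ∃ (φ : ℂ →ₐ[ℝ] ℍ[ℝ]) (π : ℍ[ℝ] →L[ℝ] ℂ), (∀ z, ‖φ z‖ = ‖z‖) ∧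
    (∀ z h, π (φ z * h) = z * π h) ∧ (∀ h, ‖π h‖ ≤ ‖h‖) ∧ π 1 = 1 ∧ ∃ z, φ z = v := by
  have hex : ∀ b c d : ℝ, ∃ I : ℍ[ℝ], I.re = 0 ∧ I.imI = b ∧ I.imJ = c ∧ I.imK = d :=
    fun b c d => ⟨⟨0, b, c, d⟩, rfl, rfl, rfl, rfl⟩
  obtain ⟨I, hI0, hI1, x, y, hv⟩ : ∃ I : ℍ[ℝ], I.re = 0 ∧ I.imI ^ 2 + I.imJ ^ 2 + I.imK ^ 2 = 1 ∧
      ∃ x y : ℝ, v = (x : ℍ[ℝ]) + y • I := by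
    by_cases h : v.imI ^ 2 + v.imJ ^ 2 + v.imK ^ 2 = 0
    · obtain ⟨I, i0, i1, i2, i3⟩ := hex 1 0 0
      refine ⟨I, i0, by rw [i1, i2, i3]; norm_num, v.re, 0, ?_⟩
      have h1 : v.imI = 0 := by nlinarith [sq_nonneg v.imI, sq_nonneg v.imJ, sq_nonneg v.imK]
      have h2 : v.imJ = 0 := by nlinarith [sq_nonneg v.imI, sq_nonneg v.imJ, sq_nonneg v.imK]
      have h3 : v.imK = 0 := by nlinarith [sq_nonneg v.imI, sq_nonneg v.imJ, sq_nonneg v.imK]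
      ext <;> simp [h1, h2, h3]
    · have hp : 0 < v.imI ^ 2 + v.imJ ^ 2 + v.imK ^ 2 := lt_of_le_of_ne (by positivity) (Ne.symm h)
      set s := Real.sqrt (v.imI ^ 2 + v.imJ ^ 2 + v.imK ^ 2) with hs
      have hs0 : 0 < s := Real.sqrt_pos.2 hp
      have hs2 : s ^ 2 = v.imI ^ 2 + v.imJ ^ 2 + v.imK ^ 2 := Real.sq_sqrt hp.le
      obtain ⟨I, i0, i1, i2, i3⟩ := hex (v.imI / s) (v.imJ / s) (v.imK / s)
      refine ⟨I, i0, ?_, v.re, s, ?_⟩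
      · rw [i1, i2, i3]
        field_simp
        exact hs2.symm
      · ext <;> simp [i0, i1, i2, i3] <;> field_simp
  have hII : I * I = -1 := by
    ext
    · simp [hI0]; linarith
    · simp [hI0]; try ring
    · simp [hI0]; try ring
    · simp [hI0]; try ring
  let φ : ℂ →ₐ[ℝ] ℍ[ℝ] := Complex.liftAux I hII
  have hφ : ∀ z, φ z = (z.re : ℍ[ℝ]) + z.im • I := fun z => Complex.liftAux_apply I hII z
  let π₀ : ℍ[ℝ] →ₗ[ℝ] ℂ :=
    { toFun := fun h => ⟨h.re, -(I * h).re⟩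
      map_add' := by
        intro a b
        apply Complex.ext
        · simp
        · simp; ring
      map_smul' := by
        intro a b
        apply Complex.ext
        · simp
        · simp; ring }
  have hπ : ∀ h, LinearMap.toContinuousLinearMap π₀ h = ⟨h.re, -(I * h).re⟩ := fun h => rfl
  refine ⟨φ, LinearMap.toContinuousLinearMap π₀, ?_, ?_, ?_, ?_, ⟨⟨x, y⟩, ?_⟩⟩
  · intro z
    rw [← sq_eq_sq₀ (norm_nonneg _) (norm_nonneg _), hφ, Complex.sq_norm, Complex.normSq_apply, sq,
      ← Quaternion.normSq_eq_norm_mul_self, Quaternion.normSq_def']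
    simp [hI0]
    linear_combination z.im ^ 2 * hI1
  · intro z h
    rw [hπ, hπ, hφ]
    apply Complex.ext
    · simp [hI0]; ring
    · simp [hI0]
      linear_combination (z.im * h.re) * hI1
  · intro h
    rw [hπ, ← sq_le_sq₀ (norm_nonneg _) (norm_nonneg _), Complex.sq_norm, Complex.normSq_apply, sq ‖h‖,
      ← Quaternion.normSq_eq_norm_mul_self, Quaternion.normSq_def']
    simp [hI0]
    nlinarith [sq_nonneg (I.imI * h.imJ - I.imJ * h.imI), sq_nonneg (I.imI * h.imK - I.imK * h.imI), sq_nonneg (I.imK * h.imJ - I.imJ * h.imK)]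
  · rw [hπ]
    apply Complex.ext <;> simp [hI0]
  · rw [hφ, hv]

lemma bg_max (k : ℕ) (N : ℂ → ℂ) (hN : DifferentiableOn ℂ N (Metric.ball 0 1))
    (hb : ∀ z : ℂ, ‖z‖ < 1 → ‖z ^ k * N z‖ ≤ 1) (z : ℂ) (hz : ‖z‖ < 1) : ‖N z‖ ≤ 1 := by
  have key : ∀ r : ℝ, ‖z‖ < r → r < 1 → r ^ k * ‖N z‖ ≤ 1 := by
    intro r hr hr1
    have hr0 : 0 < r := lt_of_le_of_lt (norm_nonneg _) hr
    have hd : DiffContOnCl ℂ N (Metric.ball 0 r) := by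
      apply DifferentiableOn.diffContOnCl
      apply hN.mono
      rw [closure_ball _ hr0.ne']
      exact Metric.closedBall_subset_ball hr1
    have := Complex.norm_le_of_forall_mem_frontier_norm_le (C := (r ^ k)⁻¹) Metric.isBounded_ball hd
      (by
        intro w hw
        rw [frontier_ball _ hr0.ne', mem_sphere_zero_iff_norm] at hw
        have := hb w (by rw [hw]; exact hr1)
        rw [norm_mul, norm_pow, hw] at this
        rw [← one_div, le_div_iff₀ (by positivity)]
        linarith) (subset_closure (by simpa using hr : z ∈ Metric.ball (0 : ℂ) r))
    rw [← one_div, le_div_iff₀ (by positivity)] at this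
    linarith
  have ht : Filter.Tendsto (fun r : ℝ => r ^ k * ‖N z‖) (nhdsWithin 1 (Set.Iio 1)) (nhds (1 ^ k * ‖N z‖)) :=
    ((by fun_prop : Continuous (fun r : ℝ => r ^ k * ‖N z‖)).tendsto 1).mono_left nhdsWithin_le_nhds
  rw [one_pow, one_mul] at ht
  refine le_of_tendsto ht ?_
  filter_upwards [Ioo_mem_nhdsLT hz] with r hr using key r hr.1 hr.2

lemma bg_diff (c : ℕ → ℂ) (hc : ∀ z : ℂ, ‖z‖ < 1 → Summable fun j => z ^ j * c j) :
    DifferentiableOn ℂ (fun z => ∑' j, z ^ j * c j) (Metric.ball 0 1) := by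
  have hrad : 1 ≤ (FormalMultilinearSeries.ofScalars ℂ c).radius := by
    refine ENNReal.le_of_forall_nnreal_lt fun r hr => ?_
    apply FormalMultilinearSeries.le_radius_of_tendsto (l := 0)
    have hr' : ‖((r : ℝ) : ℂ)‖ < 1 := by
      simp; exact_mod_cast hr
    have := (hc _ hr').tendsto_atTop_zero.norm
    simp only [FormalMultilinearSeries.ofScalars_norm]
    simpa [mul_comm] using this
  have h1 := ((FormalMultilinearSeries.ofScalars ℂ c).hasFPowerSeriesOnBall (lt_of_lt_of_le one_pos hrad)).differentiableOn
  have h2 : (FormalMultilinearSeries.ofScalars ℂ c).sum = fun z => ∑' j, z ^ j * c j := by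
    funext z
    have := FormalMultilinearSeries.ofScalars_sum_eq (E := ℂ) c z
    rw [FormalMultilinearSeries.ofScalarsSum] at this
    rw [this]
    simp [mul_comm]
  rw [h2] at h1
  apply h1.mono
  intro z hz
  rw [mem_ball_zero_iff] at hz
  rw [Metric.mem_eball, edist_zero_right]
  refine lt_of_lt_of_le ?_ hrad
  rw [← ofReal_norm]
  exact ENNReal.ofReal_lt_one.2 hz

lemma bg_shift (k : ℕ) (d : ℕ → ℂ) (hd : ∀ z : ℂ, ‖z‖ < 1 → Summable fun j => z ^ j * d j) :
    ∀ z : ℂ, ‖z‖ < 1 → Summable fun j => z ^ j * d (j + k) := by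
  intro z hz
  by_cases h0 : z = 0
  · subst h0
    apply summable_of_ne_finset_zero (s := {0})
    intro b hb
    simp at hb
    simp [hb]
  · have := ((summable_nat_add_iff k).2 (hd z hz)).mul_left ((z ^ k)⁻¹)
    refine this.congr fun j => ?_
    rw [pow_add]; field_simp

lemma bg_schwarz (k : ℕ) (d : ℕ → ℂ) (hd : ∀ z : ℂ, ‖z‖ < 1 → Summable fun j => z ^ j * d j)
    (hb : ∀ z : ℂ, ‖z‖ < 1 → ‖∑' j, z ^ j * d j‖ ≤ 1) (h0 : ∀ j < k, d j = 0)
    (z : ℂ) (hz : ‖z‖ < 1) : ‖∑' j, z ^ j * d j‖ ≤ ‖z‖ ^ k := by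
  have hf : ∀ z : ℂ, ‖z‖ < 1 → ∑' j, z ^ j * d j = z ^ k * ∑' j, z ^ j * d (j + k) := by
    intro z hz
    rw [← (hd z hz).sum_add_tsum_nat_add k, Finset.sum_eq_zero, zero_add, ← tsum_mul_left]
    · congr 1; ext j; ring
    · intro j hj; rw [h0 j (Finset.mem_range.1 hj), mul_zero]
  have := bg_max k (fun z => ∑' j, z ^ j * d (j + k)) (bg_diff _ (bg_shift k d hd))
    (by intro z hz; rw [← hf z hz]; exact hb z hz) z hz
  rw [hf z hz, norm_mul, norm_pow]
  exact mul_le_of_le_one_right (by positivity) this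

/-- coefficient bound when intermediate coefficients vanish -/
lemma bg_coef0 (k : ℕ) (hk : 1 ≤ k) (d : ℕ → ℂ)
    (hd : ∀ z : ℂ, ‖z‖ < 1 → Summable fun j => z ^ j * d j)
    (hb : ∀ z : ℂ, ‖z‖ < 1 → ‖∑' j, z ^ j * d j‖ < 1) (h0 : ∀ j, 1 ≤ j → j < k → d j = 0) :
    ‖d k‖ ≤ 1 - ‖d 0‖ ^ 2 := by
  have ev0 : ∀ e : ℕ → ℂ, ∑' j, (0 : ℂ) ^ j * e j = e 0 := by
    intro e
    rw [tsum_eq_single 0]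
    · simp
    · intro j hj; simp [hj]
  have ha : ‖d 0‖ < 1 := by
    have := hb 0 (by simp)
    rwa [ev0] at this
  have hf : ∀ z : ℂ, ‖z‖ < 1 → ∑' j, z ^ j * d j = d 0 + z ^ k * ∑' j, z ^ j * d (j + k) := by
    intro z hz
    rw [← (hd z hz).sum_add_tsum_nat_add k, ← tsum_mul_left, Finset.sum_eq_single 0]
    · congr 1
      · simp
      · congr 1; ext j; ring
    · intro j hj hj0; rw [h0 j (by omega) (Finset.mem_range.1 hj), mul_zero]
    · intro h; simp at h; omega
  set G : ℂ → ℂ := fun z => ∑' j, z ^ j * d j with hG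
  set a := d 0
  have hne : ∀ z : ℂ, ‖z‖ < 1 → 1 - (starRingEnd ℂ) a * G z ≠ 0 := by
    intro z hz h
    have h1 : (starRingEnd ℂ) a * G z = 1 := by linear_combination -h
    have h2 := congrArg norm h1
    rw [norm_mul, RCLike.norm_conj, norm_one] at h2
    have := hb z hz
    nlinarith [norm_nonneg a, norm_nonneg (G z)]
  have hmob : ∀ w : ℂ, ‖w‖ < 1 → ‖w - a‖ ≤ ‖1 - (starRingEnd ℂ) a * w‖ := by
    intro w hw
    rw [← sq_le_sq₀ (norm_nonneg _) (norm_nonneg _)]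
    have e : ‖1 - (starRingEnd ℂ) a * w‖ ^ 2 - ‖w - a‖ ^ 2 = (1 - ‖a‖ ^ 2) * (1 - ‖w‖ ^ 2) := by
      simp only [Complex.sq_norm, Complex.normSq_apply]
      simp
      ring
    have h1 : 0 ≤ 1 - ‖a‖ ^ 2 := by nlinarith [norm_nonneg a]
    have h2 : 0 ≤ 1 - ‖w‖ ^ 2 := by nlinarith [norm_nonneg w]
    nlinarith [mul_nonneg h1 h2]
  have := bg_max k (fun z => (∑' j, z ^ j * d (j + k)) / (1 - (starRingEnd ℂ) a * G z))
    (by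
      apply DifferentiableOn.div (bg_diff _ (bg_shift k d hd))
      · exact (differentiableOn_const _).sub ((differentiableOn_const _).mul (bg_diff d hd))
      · intro z hz; exact hne z (by simpa using hz))
    (by
      intro z hz
      have e : z ^ k * ∑' j, z ^ j * d (j + k) = G z - a := by linear_combination -(hf z hz)
      rw [← mul_div_assoc, e, norm_div]
      exact div_le_one_of_le₀ (hmob _ (hb z hz)) (norm_nonneg _)) 0 (by simp)
  have hG0 : G 0 = a := ev0 d
  simp only [hG0] at this
  rw [ev0 (fun j => d (j + k)), norm_div] at this
  have e2 : ‖1 - (starRingEnd ℂ) a * a‖ = 1 - ‖a‖ ^ 2 := by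
    have : 1 - (starRingEnd ℂ) a * a = ((1 - ‖a‖ ^ 2 : ℝ) : ℂ) := by
      rw [mul_comm, Complex.mul_conj, Complex.normSq_eq_norm_sq]; push_cast; rfl
    rw [this, Complex.norm_real, Real.norm_of_nonneg]
    nlinarith [norm_nonneg a]
  rw [e2, div_le_one (by nlinarith [norm_nonneg a])] at this
  simpa using this

lemma bg_coef (k : ℕ) (hk : 1 ≤ k) (c : ℕ → ℂ)
    (hc : ∀ z : ℂ, ‖z‖ < 1 → Summable fun j => z ^ j * c j)
    (hb : ∀ z : ℂ, ‖z‖ < 1 → ‖∑' j, z ^ j * c j‖ < 1) :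
    ‖c k‖ ≤ 1 - ‖c 0‖ ^ 2 := by
  have hk0 : (k : ℂ) ≠ 0 := by exact_mod_cast (by omega : k ≠ 0)
  have hkr : (0 : ℝ) < k := by exact_mod_cast hk
  obtain ⟨ζ, hζ⟩ : ∃ ζ : ℂ, IsPrimitiveRoot ζ k := ⟨_, Complex.isPrimitiveRoot_exp k (by omega)⟩
  have hζn : ‖ζ‖ = 1 := hζ.norm'_eq_one (by omega)
  let d : ℕ → ℂ := fun j => (k : ℂ)⁻¹ * (∑ i ∈ Finset.range k, (ζ ^ j) ^ i) * c j
  have hzn : ∀ z : ℂ, ‖z‖ < 1 → ∀ i, ‖ζ ^ i * z‖ < 1 := by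
    intro z hz i; rw [norm_mul, norm_pow, hζn]; simpa using hz
  have hs : ∀ z : ℂ, ‖z‖ < 1 → HasSum (fun j => z ^ j * d j)
      ((k : ℂ)⁻¹ * ∑ i ∈ Finset.range k, ∑' j, (ζ ^ i * z) ^ j * c j) := by
    intro z hz
    have := (hasSum_sum (s := Finset.range k) fun i _ => (hc _ (hzn z hz i)).hasSum).mul_left ((k : ℂ)⁻¹)
    suffices e : (fun j => z ^ j * d j) =
        fun i => (k : ℂ)⁻¹ * ∑ l ∈ Finset.range k, (ζ ^ l * z) ^ i * c i by
      rw [e]; exact this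
    funext j
    simp only [d, Finset.mul_sum, Finset.sum_mul]
    apply Finset.sum_congr rfl
    intro i _
    rw [mul_pow, ← pow_mul, ← pow_mul, mul_comm i j]; ring
  have h := bg_coef0 k hk d (fun z hz => (hs z hz).summable)
    (by
      intro z hz
      rw [(hs z hz).tsum_eq, norm_mul, norm_inv, Complex.norm_natCast, inv_mul_lt_iff₀ hkr, mul_one]
      refine lt_of_le_of_lt (norm_sum_le _ _) ?_
      have := Finset.sum_lt_sum_of_nonempty (s := Finset.range k) (Finset.nonempty_range_iff.2 (by omega))
        (fun i _ => hb _ (hzn z hz i))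
      simpa using this)
    (by
      intro j hj hjk
      have h1 : ζ ^ j ≠ 1 := hζ.pow_ne_one_of_pos_of_lt (by omega) hjk
      have : ∑ i ∈ Finset.range k, (ζ ^ j) ^ i = 0 := by
        rw [geom_sum_eq h1, ← pow_mul, mul_comm, pow_mul, hζ.pow_eq_one]; simp
      simp [d, this])
  have e0 : d 0 = c 0 := by simp [d, hk0]
  have ek : d k = c k := by simp [d, hζ.pow_eq_one, hk0]
  rwa [e0, ek] at h

lemma bg_transfer (p : ℕ → ℍ[ℝ]) (hp : SBClass p) (φ : ℂ →ₐ[ℝ] ℍ[ℝ]) (π : ℍ[ℝ] →L[ℝ] ℂ)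
    (h1 : ∀ z, ‖φ z‖ = ‖z‖) (h2 : ∀ z h, π (φ z * h) = z * π h) (u : ℍ[ℝ]) (z : ℂ) (hz : ‖z‖ < 1) :
    HasSum (fun j => z ^ j * π (p j * u)) (π (sliceVal p (φ z) * u)) := by
  have hs := (hp.1 (φ z) (by rwa [h1])).hasSum
  have := (hs.mul_right u).mapL π
  have e : (fun j => z ^ j * π (p j * u)) = fun b => π (φ z ^ b * p b * u) := by
    funext j
    rw [mul_assoc, ← map_pow, h2]
  rw [e]
  exact this

lemma bg_unit (v : ℍ[ℝ]) : ∃ u : ℍ[ℝ], ‖u‖ = 1 ∧ v * u = ((‖v‖ : ℝ) : ℍ[ℝ]) := by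
  by_cases h : v = 0
  · exact ⟨1, by simp, by simp [h]⟩
  · have hn : ‖v‖ ≠ 0 := by simpa using h
    refine ⟨v⁻¹ * ((‖v‖ : ℝ) : ℍ[ℝ]), ?_, ?_⟩
    · rw [norm_mul, norm_inv, Quaternion.norm_coe, norm_norm, inv_mul_cancel₀ hn]
    · rw [← mul_assoc, mul_inv_cancel₀ h, one_mul]

lemma bg_sub (p : ℕ → ℍ[ℝ]) (hp : SBClass p) (k : ℕ) (hk : 1 ≤ k) : ‖p k‖ ≤ 1 - ‖p 0‖ ^ 2 := by
  obtain ⟨u, hu, hpu⟩ := bg_unit (p 0)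
  obtain ⟨φ, π, h1, h2, h3, h4, z, hz⟩ := bg_slice (p k * u)
  have hT := bg_transfer p hp φ π h1 h2 u
  have := bg_coef k hk (fun j => π (p j * u)) (fun z hz => (hT z hz).summable) (by
    intro z hz
    rw [(hT z hz).tsum_eq]
    refine lt_of_le_of_lt (h3 _) ?_
    rw [norm_mul, hu, mul_one]
    exact hp.2 _ (by rwa [h1]))
  have hφπ : ∀ z, π (φ z) = z := fun z => by simpa [h4] using h2 z 1
  have e0 : ‖π (p 0 * u)‖ = ‖p 0‖ := by
    have : ((‖p 0‖ : ℝ) : ℍ[ℝ]) = φ ((‖p 0‖ : ℝ) : ℂ) := (φ.commutes ‖p 0‖).symm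
    rw [hpu, this, hφπ]; simp
  have ek : ‖π (p k * u)‖ = ‖p k‖ := by
    rw [← hz, hφπ, ← h1, hz, norm_mul, hu, mul_one]
  simp only [e0, ek] at this
  exact this

lemma bg_sw (k : ℕ) (p : ℕ → ℍ[ℝ]) (hp : SBnClass k p) (q : ℍ[ℝ]) (hq : ‖q‖ < 1) :
    ‖sliceVal p q‖ ≤ ‖q‖ ^ k := by
  obtain ⟨u, hu, hpu⟩ := bg_unit (sliceVal p q)
  obtain ⟨φ, π, h1, h2, h3, h4, z, hz⟩ := bg_slice q
  have hT := bg_transfer p hp.1 φ π h1 h2 u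
  have hzq : ‖z‖ = ‖q‖ := by rw [← h1, hz]
  have := bg_schwarz k (fun j => π (p j * u)) (fun z hz => (hT z hz).summable) (by
    intro z hz
    rw [(hT z hz).tsum_eq]
    refine le_trans (h3 _) ?_
    rw [norm_mul, hu, mul_one]
    exact (hp.1.2 _ (by rwa [h1])).le) (by intro j hj; simp [hp.2.1 j hj]) z (by rwa [hzq])
  rw [(hT z (by rwa [hzq])).tsum_eq, hz, hpu, hzq] at this
  have hφπ : ∀ z, π (φ z) = z := fun z => by simpa [h4] using h2 z 1
  have e : ((‖sliceVal p q‖ : ℝ) : ℍ[ℝ]) = φ ((‖sliceVal p q‖ : ℝ) : ℂ) := (φ.commutes _).symm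
  rw [e, hφπ] at this
  simpa using this

theorem bohr_generalized (m : ℝ) (hm0 : 0 < m) (hm2 : m ≤ 2)
    (p : ℕ → ℍ[ℝ]) (hp : SBClass p)
    (w : ℕ → ℕ → ℍ[ℝ]) (hw : ∀ k, 1 ≤ k → SBnClass k (w k))
    (q : ℍ[ℝ]) (hq : ‖q‖ < 1) (hqr : ‖q‖ ≤ m / (2 + m)) :
    ‖p 0‖ ^ m + ∑' k : ℕ, ‖sliceVal (w (k + 1)) q‖ * ‖p (k + 1)‖ ≤ 1 := by
  set a := ‖p 0‖ with ha
  set r := ‖q‖ with hr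
  have ha0 : 0 ≤ a := norm_nonneg _
  have hr0 : 0 ≤ r := norm_nonneg _
  have hb : 0 ≤ 1 - a ^ 2 := (norm_nonneg _).trans (bg_sub p hp 1 le_rfl)
  have hle : ∀ k : ℕ, ‖sliceVal (w (k + 1)) q‖ * ‖p (k + 1)‖ ≤ r ^ k * (r * (1 - a ^ 2)) := by
    intro k
    have h1 := bg_sw (k + 1) (w (k + 1)) (hw _ (by omega)) q hq
    have h2 := bg_sub p hp (k + 1) (by omega)
    calc _ ≤ r ^ (k + 1) * (1 - a ^ 2) := mul_le_mul h1 h2 (norm_nonneg _) (by positivity)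
      _ = _ := by ring
  have hg := (hasSum_geometric_of_lt_one hr0 hq).mul_right (r * (1 - a ^ 2))
  have hsum : ∑' k : ℕ, ‖sliceVal (w (k + 1)) q‖ * ‖p (k + 1)‖ ≤ (1 - r)⁻¹ * (r * (1 - a ^ 2)) := by
    rw [← hg.tsum_eq]
    exact (Summable.of_nonneg_of_le (fun k => by positivity) hle hg.summable).tsum_le_tsum hle hg.summable
  have hrm : (1 - r)⁻¹ * r ≤ m / 2 := by
    rw [inv_mul_le_iff₀ (by linarith)]
    rw [le_div_iff₀ (by linarith)] at hqr
    nlinarith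
  have hbern : a ^ m ≤ 1 + m / 2 * (a ^ 2 - 1) := by
    have h := rpow_one_add_le_one_add_mul_self (s := a ^ 2 - 1) (p := m / 2)
      (by nlinarith [sq_nonneg a]) (by linarith) (by linarith)
    have e : (1 + (a ^ 2 - 1)) ^ (m / 2) = a ^ m := by
      rw [add_sub_cancel, ← Real.rpow_natCast, ← Real.rpow_mul ha0]
      congr 1; push_cast; ring
    rwa [e] at h
  have := mul_le_mul_of_nonneg_right hrm hb
  nlinarith
end
end

section
/- The constant m/(2+m) in the generalized Bohr theorem is best possible: for every m ∈ (0,2] and every r with m/(2+m) < r < 1, there exist a function f(q) = ∑_{k=0}^∞ qᵏ pₖ ∈ SB(𝔹), functions ωₖ ∈ SB_k(𝔹) for k ≥ 1, and a point q ∈ 𝔹 with |q| = r such that |p₀|^m + ∑_{k=1}^∞ |ωₖ(q)| |pₖ| > 1 (for instance ωₖ(q) = qᵏ and f = f_a with p₀ = a, pₖ = −(1−a²)a^{k−1} for k ≥ 1, for a ∈ (0,1) close enough to 1). -/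
noncomputable section
open scoped Quaternion

theorem aux_exists (m r : ℝ) (hm0 : 0 < m) (hr1 : m / (2 + m) < r) (hr2 : r < 1) :
    ∃ a : ℝ, 0 < a ∧ a < 1 ∧ 1 < a ^ m + (1 - a ^ 2) * r / (1 - a * r) := by
  have h1r : (1 - r) ≠ 0 := by linarith
  have hd : HasDerivAt (fun a : ℝ => a ^ m + (1 - a ^ 2) * r / (1 - a * r))
      (m - 2 * r / (1 - r)) 1 := by
    have e1 : HasDerivAt (fun a : ℝ => a ^ m) (m * 1 ^ (m - 1)) 1 :=
      Real.hasDerivAt_rpow_const (Or.inl one_ne_zero)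
    have e2 : HasDerivAt (fun a : ℝ => (1 - a ^ 2) * r) (-(2 * 1) * r) 1 := by
      have := (((hasDerivAt_id (1 : ℝ)).pow 2).const_sub 1).mul_const r
      simpa using this
    have e3 : HasDerivAt (fun a : ℝ => 1 - a * r) (-(1 * r)) 1 := by
      have := ((hasDerivAt_id (1 : ℝ)).mul_const r).const_sub 1
      simpa using this
    have e4 := e1.add (e2.div e3 (by simpa using h1r))
    refine HasDerivAt.congr_deriv e4 ?_
    rw [Real.one_rpow]
    field_simp
    ring
  have hneg : m - 2 * r / (1 - r) < 0 := by
    have h2 : 0 < 2 + m := by linarith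
    rw [div_lt_iff₀ h2] at hr1
    have : m < 2 * r / (1 - r) := by
      rw [lt_div_iff₀ (by linarith)]
      nlinarith
    linarith
  have hs := (hasDerivAt_iff_tendsto_slope.1 hd).eventually (gt_mem_nhds hneg)
  have hs' := hs.filter_mono (nhdsWithin_mono (1 : ℝ)
    (s := Set.Iio 1) (fun x hx => ne_of_lt hx))
  have h0 : ∀ᶠ x : ℝ in nhdsWithin 1 (Set.Iio 1), x ∈ Set.Ioo (0 : ℝ) 1 :=
    Ioo_mem_nhdsLT one_pos
  obtain ⟨a, ha, ha0, ha1⟩ := (hs'.and h0).exists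
  refine ⟨a, ha0, ha1, ?_⟩
  rw [slope_def_field] at ha
  have h3 : a - 1 < 0 := by linarith
  by_contra hcon
  push Not at hcon
  have : 0 ≤ ((a ^ m + (1 - a ^ 2) * r / (1 - a * r)) -
      ((1:ℝ) ^ m + (1 - (1:ℝ) ^ 2) * r / (1 - 1 * r))) / (a - 1) := by
    apply div_nonneg_of_nonpos _ h3.le
    simp
    linarith
  linarith

/-- Coefficients of the Moebius map. -/
def mobC (a : ℝ) : ℕ → ℍ[ℝ]
  | 0 => (a : ℍ[ℝ])
  | k + 1 => ((-((1 - a ^ 2) * a ^ k) : ℝ) : ℍ[ℝ])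

theorem mob_hasSum (a : ℝ) (ha0 : 0 < a) (ha1 : a < 1) (q : ℍ[ℝ]) (hq : ‖q‖ < 1) :
    HasSum (fun k => q ^ k * mobC a k)
      ((a : ℍ[ℝ]) + (-(1 - a ^ 2) : ℝ) • (q * (1 - a • q)⁻¹)) := by
  have hn : ‖a • q‖ < 1 := by
    rw [norm_smul, Real.norm_of_nonneg ha0.le]
    nlinarith [norm_nonneg q]
  have h := ((hasSum_geometric_of_norm_lt_one hn).mul_left q).const_smul (-(1 - a ^ 2) : ℝ)
  have h2 : HasSum (fun k => q ^ (k+1) * mobC a (k+1))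
      ((-(1 - a ^ 2) : ℝ) • (q * (1 - a • q)⁻¹)) := by
    refine (congrArg (fun f => HasSum f _) (funext fun k => ?_)).mpr h
    have e : mobC a (k + 1) = ((-((1 - a ^ 2) * a ^ k) : ℝ) : ℍ[ℝ]) := rfl
    rw [e, Quaternion.mul_coe_eq_smul, smul_pow, mul_smul_comm, smul_smul, pow_succ' q k]
    congr 1
    ring
  have h3 := HasSum.zero_add (f := fun k => q ^ k * mobC a k) h2
  have e0 : q ^ 0 * mobC a 0 = (a : ℍ[ℝ]) := by
    rw [pow_zero, one_mul]; rfl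
  rw [← e0]
  exact h3

theorem mob_SB (a : ℝ) (ha0 : 0 < a) (ha1 : a < 1) : SBClass (mobC a) := by
  refine ⟨fun q hq => (mob_hasSum a ha0 ha1 q hq).summable, fun q hq => ?_⟩
  rw [sliceVal, (mob_hasSum a ha0 ha1 q hq).tsum_eq]
  have hn : ‖a • q‖ < 1 := by
    rw [norm_smul, Real.norm_of_nonneg ha0.le]
    nlinarith [norm_nonneg q]
  have hne : (1 - a • q) ≠ 0 := by
    intro h
    rw [sub_eq_zero] at h
    rw [← h] at hn
    simp at hn
  have hE : (a : ℍ[ℝ]) + (-(1 - a ^ 2) : ℝ) • (q * (1 - a • q)⁻¹)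
      = ((a : ℍ[ℝ]) - q) * (1 - a • q)⁻¹ := by
    rw [eq_mul_inv_iff_mul_eq₀ hne, add_mul, smul_mul_assoc, inv_mul_cancel_right₀ hne,
      Quaternion.coe_mul_eq_smul, smul_sub, smul_smul]
    have : a • (1 : ℍ[ℝ]) = (a : ℍ[ℝ]) := by
      rw [← Quaternion.coe_mul_eq_smul, mul_one]
    rw [this]
    module
  rw [hE, norm_mul, norm_inv, ← div_eq_mul_inv, div_lt_one (norm_pos_iff.2 hne)]
  apply lt_of_pow_lt_pow_left₀ 2 (norm_nonneg _)
  have hq2 : ‖q‖ ^ 2 < 1 := by nlinarith [norm_nonneg q]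
  have key : ∀ x : ℍ[ℝ], ‖x‖ ^ 2 = x.re ^ 2 + x.imI ^ 2 + x.imJ ^ 2 + x.imK ^ 2 := by
    intro x
    rw [sq, ← Quaternion.normSq_eq_norm_mul_self, Quaternion.normSq_def']
  rw [key] at hq2
  rw [key, key]
  simp
  nlinarith [mul_pos (sub_pos.2 hq2) (show 0 < 1 - a ^ 2 by nlinarith)]

theorem mon_hasSum (n : ℕ) (q : ℍ[ℝ]) :
    HasSum (fun k => q ^ k * (Pi.single n (1 : ℍ[ℝ]) : ℕ → ℍ[ℝ]) k) (q ^ n) := by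
  have := hasSum_single (f := fun k => q ^ k * (Pi.single n (1 : ℍ[ℝ]) : ℕ → ℍ[ℝ]) k) n
    (fun k hk => by simp [Pi.single_eq_of_ne hk])
  simpa using this

theorem bohr_generalized_sharp (m : ℝ) (hm0 : 0 < m) (hm2 : m ≤ 2)
    (r : ℝ) (hr1 : m / (2 + m) < r) (hr2 : r < 1) :
    ∃ (p : ℕ → ℍ[ℝ]) (w : ℕ → ℕ → ℍ[ℝ]) (q : ℍ[ℝ]),
      SBClass p ∧ (∀ k, 1 ≤ k → SBnClass k (w k)) ∧ ‖q‖ = r ∧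
      1 < ‖p 0‖ ^ m + ∑' k : ℕ, ‖sliceVal (w (k + 1)) q‖ * ‖p (k + 1)‖ := by
  have hr0 : 0 < r := lt_trans (by positivity) hr1
  obtain ⟨a, ha0, ha1, ha⟩ := aux_exists m r hm0 hr1 hr2
  refine ⟨mobC a, fun n => Pi.single n 1, (r : ℍ[ℝ]), mob_SB a ha0 ha1, ?_, ?_, ?_⟩
  · intro k hk
    refine ⟨⟨fun q _ => (mon_hasSum k q).summable, fun q hq => ?_⟩, ?_, by simp⟩
    · rw [sliceVal, (mon_hasSum k q).tsum_eq, norm_pow]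
      exact pow_lt_one₀ (norm_nonneg _) hq (by omega)
    · intro j hj
      exact Pi.single_eq_of_ne hj.ne _
  · rw [Quaternion.norm_coe, Real.norm_of_nonneg hr0.le]
  · have hc : 0 < 1 - a ^ 2 := by nlinarith
    have har : a * r < 1 := by nlinarith
    have h := (hasSum_geometric_of_lt_one (by positivity) har).mul_left ((1 - a ^ 2) * r)
    have e : ∀ k : ℕ, ‖sliceVal (Pi.single (k + 1) 1) (r : ℍ[ℝ])‖ * ‖mobC a (k + 1)‖
        = (1 - a ^ 2) * r * (a * r) ^ k := by
      intro k
      rw [sliceVal, (mon_hasSum (k+1) _).tsum_eq, norm_pow, mobC, Quaternion.norm_coe,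
        Quaternion.norm_coe, Real.norm_of_nonneg hr0.le, norm_neg,
        Real.norm_of_nonneg (by positivity)]
      ring
    simp only [e]
    rw [h.tsum_eq, mobC, Quaternion.norm_coe, Real.norm_of_nonneg ha0.le, ← div_eq_mul_inv]
    exact ha
end
end
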